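/- arXiv:1102.5136 — 3 statements merged into one kernel-verified Lean document; each statement's English description precedes it below -/
import Mathlib

section
/- Let m ≥ 2, let q ≥ 2 be an integer, and let Ω be a nonempty closed subset of Σ_m. Then the Hausdorff dimension of Ξ_Ω equals the supremum, over all Borel probability measures μ supported on Ω, of s(Ω,μ); moreover this supremum is attained. -/
open scoped Classical ENNReal
open Filter MeasureTheory Topology

noncomputable section

/-- `Begins x u` : the finite word `u` is a prefix of the sequence `x` (indexed by `ℕ+`). -/
def Begins {m : ℕ} (x : ℕ+ → Fin m) (u : List (Fin m)) : Prop :=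
  ∀ j : Fin u.length, x ⟨(j : ℕ) + 1, Nat.succ_pos _⟩ = u.get j

/-- `Cyl u` : the cylinder set of the word `u`. -/
def Cyl {m : ℕ} (u : List (Fin m)) : Set (ℕ+ → Fin m) := {x | Begins x u}

/-- `Pref Ω` : the set of (finite) prefixes of sequences in `Ω`. -/
def Pref {m : ℕ} (Ω : Set (ℕ+ → Fin m)) : Set (List (Fin m)) := {u | ∃ x ∈ Ω, Begins x u}

/-- number of length-`n` words beginning some sequence of `X`. -/
def NWords {m : ℕ} (n : ℕ) (X : Set (ℕ+ → Fin m)) : ℕ :=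
  Set.ncard {u : List (Fin m) | u.length = n ∧ u ∈ Pref X}

/-- restriction of `x` to the geometric progression `J_i = {i, qi, q²i, …}`:
`(x|J_i)_k = x_{q^{k-1} i}` for `k ≥ 1`. -/
def RestrJ {m : ℕ} (q : ℕ+) (x : ℕ+ → Fin m) (i : ℕ+) : ℕ+ → Fin m :=
  fun k => x (q ^ ((k : ℕ) - 1) * i)

/-- the multiplicative subshift `X_Ω = {x : x|J_i ∈ Ω for all i with q ∤ i}`. -/
def XOm {m : ℕ} (q : ℕ+) (Ω : Set (ℕ+ → Fin m)) : Set (ℕ+ → Fin m) :=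
  {x | ∀ i : ℕ+, ¬ q ∣ i → RestrJ q x i ∈ Ω}

/-- the real number `Σ_{k≥1} x_k m^{-k}` with base-`m` digit sequence `x`. -/
def ValMap (m : ℕ) (x : ℕ+ → Fin m) : ℝ := ∑' k : ℕ+, ((x k : ℕ) : ℝ) * (m : ℝ)⁻¹ ^ (k : ℕ)

/-- the subset of `[0,1]` of reals whose base-`m` digit sequence lies in `X`. -/
def XiSet {m : ℕ} (X : Set (ℕ+ → Fin m)) : Set ℝ := {r | ∃ x ∈ X, r = ValMap m x}

/-- entropy (base-`m` logarithms) of the partition of `Ω` into `k`-cylinders, for a measure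
supported on `Ω` (words that are not prefixes of `Ω` get measure `0` and contribute nothing). -/
def Hent (m : ℕ) (μ : Measure (ℕ+ → Fin m)) (k : ℕ) : ℝ :=
  -∑ u : Fin k → Fin m,
    ((μ (Cyl (List.ofFn u))).toReal * Real.logb m (μ (Cyl (List.ofFn u))).toReal)

/-- `s(Ω,μ) = (q-1)² Σ_{k≥1} H_m^μ(α_k)/q^{k+1}`. -/
def sOm (m : ℕ) (q : ℕ+) (μ : Measure (ℕ+ → Fin m)) : ℝ :=
  ((q : ℝ) - 1) ^ 2 * ∑' k : ℕ, Hent m μ (k + 1) / (q : ℝ) ^ (k + 2)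

/-- cylinder determined by the first `n` entries of `x`, i.e. `[x₁…x_n]`. -/
def CylN {m : ℕ} (n : ℕ) (x : ℕ+ → Fin m) : Set (ℕ+ → Fin m) :=
  {y | ∀ k : ℕ+, (k : ℕ) ≤ n → y k = x k}

/-- the cylinder `[u|J_i]` where `u = x₁…x_n`: sequences `y` with
`y_{ℓ+1} = x_{q^ℓ i}` for all `ℓ ≥ 0` with `q^ℓ i ≤ n`. -/
def CylJ {m : ℕ} (q n i : ℕ+) (x : ℕ+ → Fin m) : Set (ℕ+ → Fin m) :=
  {y | ∀ ℓ : ℕ, q ^ ℓ * i ≤ n → y ⟨ℓ + 1, Nat.succ_pos _⟩ = x (q ^ ℓ * i)}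

/-- `P` has the product structure `P[u] = ∏_{i ≤ |u|, q ∤ i} μ[u|J_i]` on cylinders. -/
def ProdProp {m : ℕ} (q : ℕ+) (μ P : Measure (ℕ+ → Fin m)) : Prop :=
  ∀ (n : ℕ+) (x : ℕ+ → Fin m),
    P (CylN (n : ℕ) x) = ∏ i ∈ (Finset.Icc 1 n).filter (fun i => ¬ q ∣ i), μ (CylJ q n i x)

/-- `t` is a `[1, m^{1/(q-1)}]`-valued solution of `t(u)^q = Σ_{j : uj ∈ Pref(Ω)} t(uj)`
on the tree of prefixes of `Ω`. -/
def TSol {m : ℕ} (q : ℕ+) (Ω : Set (ℕ+ → Fin m)) (t : List (Fin m) → ℝ) : Prop :=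
  ∀ u ∈ Pref Ω,
    t u ∈ Set.Icc 1 ((m : ℝ) ^ ((1 : ℝ) / ((q : ℝ) - 1))) ∧
    t u ^ (q : ℕ) =
      ∑ j ∈ Finset.univ.filter (fun j : Fin m => u ++ [j] ∈ Pref Ω), t (u ++ [j])

/-- `μ` has the cylinder values `μ[u₁…u_k] = ∏_{j=1}^k t(u₁…u_j)/t(u₁…u_{j-1})^q`
for prefixes `u` of `Ω`. -/
def CylVals {m : ℕ} (q : ℕ+) (Ω : Set (ℕ+ → Fin m)) (t : List (Fin m) → ℝ)
    (μ : Measure (ℕ+ → Fin m)) : Prop :=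
  ∀ u ∈ Pref Ω,
    μ (Cyl u) =
      ENNReal.ofReal (∏ j ∈ Finset.range u.length, t (u.take (j + 1)) / t (u.take j) ^ (q : ℕ))

/-- The length-`k` prefix of `x`, as a list. -/
def pre {m : ℕ} (x : ℕ+ → Fin m) (k : ℕ) : List (Fin m) :=
  List.ofFn (fun j : Fin k => x ⟨(j : ℕ) + 1, Nat.succ_pos _⟩)

@[simp] lemma pre_length {m : ℕ} (x : ℕ+ → Fin m) (k : ℕ) : (pre x k).length = k := by
  simp [pre]

lemma begins_iff {m : ℕ} (x : ℕ+ → Fin m) (u : List (Fin m)) :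
    Begins x u ↔ pre x u.length = u := by
  constructor
  · intro h
    refine List.ext_get (by simp) ?_
    intro n h1 h2
    have := h ⟨n, h2⟩
    simp [pre] at this ⊢
    exact this
  · intro h j
    have h2 : (pre x u.length)[(j : ℕ)]'(by simp) = u[(j : ℕ)] := by
      simp only [h]
    simp [pre] at h2
    simpa using h2

lemma pre_succ {m : ℕ} (x : ℕ+ → Fin m) (k : ℕ) :
    pre x (k + 1) = pre x k ++ [x ⟨k + 1, Nat.succ_pos _⟩] := by
  unfold pre
  rw [List.ofFn_succ_last]
  simp

lemma pre_take {m : ℕ} (x : ℕ+ → Fin m) (k j : ℕ) (h : j ≤ k) :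
    (pre x k).take j = pre x j := by
  refine List.ext_getElem (by simp [h]) ?_
  intro n h1 h2
  simp [pre]

lemma pre_mem {m : ℕ} {Ω : Set (ℕ+ → Fin m)} {x : ℕ+ → Fin m} (hx : x ∈ Ω) (k : ℕ) :
    pre x k ∈ Pref Ω := ⟨x, hx, by rw [begins_iff]; simp⟩

lemma mem_pref_iff {m : ℕ} {Ω : Set (ℕ+ → Fin m)} (u : List (Fin m)) :
    u ∈ Pref Ω ↔ ∃ x ∈ Ω, pre x u.length = u := by
  simp [Pref, begins_iff]

lemma pref_left {m : ℕ} {Ω : Set (ℕ+ → Fin m)} {u v : List (Fin m)} (h : u ++ v ∈ Pref Ω) :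
    u ∈ Pref Ω := by
  rw [mem_pref_iff] at h
  obtain ⟨x, hx, h⟩ := h
  have := congrArg (List.take u.length) h
  rw [pre_take _ _ _ (by simp)] at this
  rw [mem_pref_iff]
  exact ⟨x, hx, by simpa using this⟩

lemma pref_ext {m : ℕ} {Ω : Set (ℕ+ → Fin m)} {u : List (Fin m)} (h : u ∈ Pref Ω) :
    ∃ j, u ++ [j] ∈ Pref Ω := by
  rw [mem_pref_iff] at h
  obtain ⟨x, hx, h⟩ := h
  exact ⟨x ⟨u.length + 1, Nat.succ_pos _⟩, by
    have := pre_mem hx (u.length + 1)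
    rwa [pre_succ, h] at this⟩

lemma mem_of_pre {m : ℕ} {Ω : Set (ℕ+ → Fin m)} (hcl : IsClosed Ω) (x : ℕ+ → Fin m)
    (h : ∀ k, pre x k ∈ Pref Ω) : x ∈ Ω := by
  rw [← hcl.closure_eq]
  choose y hy hyx using fun k => (mem_pref_iff _).1 (h k)
  refine mem_closure_of_tendsto (f := y) (b := atTop) ?_ (Eventually.of_forall hy)
  rw [tendsto_pi_nhds]
  intro r
  refine tendsto_const_nhds.congr' ?_
  filter_upwards [eventually_ge_atTop (r : ℕ)] with k hk
  have h1 := hyx k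
  rw [pre_length] at h1
  have h2 := List.ofFn_injective h1
  have hr := r.pos
  have h3 := congrFun h2 ⟨(r : ℕ) - 1, by omega⟩
  have h4 : (⟨((r : ℕ) - 1) + 1, Nat.succ_pos _⟩ : ℕ+) = r := by
    apply PNat.eq; simp; omega
  simp only [h4] at h3
  exact h3.symm

lemma mem_Cyl_pre {m : ℕ} (x y : ℕ+ → Fin m) (k : ℕ) :
    x ∈ Cyl (pre y k) ↔ pre x k = pre y k := by
  simp [Cyl, begins_iff]

lemma measurable_pre {m : ℕ} (k : ℕ) :
    Measurable (fun (x : ℕ+ → Fin m) (j : Fin k) => x ⟨(j : ℕ) + 1, Nat.succ_pos _⟩) := by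
  fun_prop

lemma Cyl_ofFn {m k : ℕ} (u : Fin k → Fin m) : Cyl (List.ofFn u) =
    (fun (x : ℕ+ → Fin m) (j : Fin k) => x ⟨(j : ℕ) + 1, Nat.succ_pos _⟩) ⁻¹' {u} := by
  ext x
  have h : x ∈ Cyl (List.ofFn u) ↔ pre x k = List.ofFn u := by
    have := begins_iff x (List.ofFn u)
    rw [List.length_ofFn] at this
    exact this
  rw [h, Set.mem_preimage, Set.mem_singleton_iff, ← List.ofFn_inj, pre]

lemma measurableSet_Cyl {m : ℕ} (u : List (Fin m)) : MeasurableSet (Cyl u) := by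
  have : u = List.ofFn u.get := by simp
  rw [this, Cyl_ofFn]
  exact measurable_pre _ (measurableSet_singleton _)

/-- the information function -/
def Yinf {m : ℕ} (μ : Measure (ℕ+ → Fin m)) (k : ℕ) (x : ℕ+ → Fin m) : ℝ :=
  - Real.logb m (μ (Cyl (pre x k))).toReal

lemma measurable_comp_pre {m : ℕ} (k : ℕ) (f : List (Fin m) → ℝ) :
    Measurable (fun x => f (pre x k)) := by
  have : (fun x : ℕ+ → Fin m => f (pre x k)) = (fun v : Fin k → Fin m => f (List.ofFn v)) ∘
      (fun (x : ℕ+ → Fin m) (j : Fin k) => x ⟨(j : ℕ) + 1, Nat.succ_pos _⟩) := rfl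
  rw [this]
  exact (measurable_of_finite _).comp (measurable_pre k)

lemma integrable_comp_pre {m : ℕ} (μ : Measure (ℕ+ → Fin m)) [IsProbabilityMeasure μ]
    (k : ℕ) (f : List (Fin m) → ℝ) :
    Integrable (fun x => f (pre x k)) μ := by
  obtain ⟨C, hC⟩ := (Set.finite_range (fun v : Fin k → Fin m => ‖f (List.ofFn v)‖)).bddAbove
  refine Integrable.of_bound (measurable_comp_pre k f).aestronglyMeasurable C ?_
  exact Eventually.of_forall fun x => hC ⟨_, rfl⟩

lemma integral_comp_pre {m : ℕ} (μ : Measure (ℕ+ → Fin m)) [IsProbabilityMeasure μ]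
    (k : ℕ) (f : List (Fin m) → ℝ) :
    ∫ x, f (pre x k) ∂μ = ∑ u : Fin k → Fin m,
      (μ (Cyl (List.ofFn u))).toReal * f (List.ofFn u) := by
  have h1 : ∫ x, f (pre x k) ∂μ = ∫ v, f (List.ofFn v) ∂(μ.map
      (fun (x : ℕ+ → Fin m) (j : Fin k) => x ⟨(j : ℕ) + 1, Nat.succ_pos _⟩)) := by
    rw [integral_map (measurable_pre k).aemeasurable
      (measurable_of_finite _).aestronglyMeasurable]
    rfl
  rw [h1, integral_fintype .of_finite]
  refine Finset.sum_congr rfl fun u _ => ?_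
  rw [Measure.real, Measure.map_apply (measurable_pre k) (measurableSet_singleton _), Cyl_ofFn]
  rfl

lemma Hent_eq_integral {m : ℕ} (μ : Measure (ℕ+ → Fin m)) [IsProbabilityMeasure μ] (k : ℕ) :
    Hent m μ k = ∫ x, Yinf μ k x ∂μ := by
  have := integral_comp_pre μ k (fun u => - Real.logb m (μ (Cyl u)).toReal)
  unfold Yinf
  rw [this, Hent]
  simp

/-- finite-depth approximations to the solution `t` -/
def fT {m : ℕ} (q : ℕ+) (Ω : Set (ℕ+ → Fin m)) : ℕ → List (Fin m) → ℝ
  | 0, _ => 1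
  | n + 1, u => (∑ j ∈ Finset.univ.filter (fun j : Fin m => u ++ [j] ∈ Pref Ω),
      fT q Ω n (u ++ [j])) ^ ((1 : ℝ) / (q : ℝ))

lemma fT_nonneg {m : ℕ} (q : ℕ+) (Ω : Set (ℕ+ → Fin m)) (n : ℕ) (u : List (Fin m)) :
    0 ≤ fT q Ω n u := by
  induction n generalizing u with
  | zero => simp [fT]
  | succ n ih => exact Real.rpow_nonneg (Finset.sum_nonneg fun j _ => ih _) _

lemma fT_mono {m : ℕ} (q : ℕ+) (Ω : Set (ℕ+ → Fin m)) (n : ℕ) (u : List (Fin m))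
    (hu : u ∈ Pref Ω) : fT q Ω n u ≤ fT q Ω (n + 1) u := by
  induction n generalizing u with
  | zero =>
    simp only [fT]
    apply Real.one_le_rpow _ (by positivity)
    rw [Finset.sum_const, nsmul_eq_mul, mul_one]
    obtain ⟨j, hj⟩ := pref_ext hu
    have : 0 < (Finset.univ.filter (fun j : Fin m => u ++ [j] ∈ Pref Ω)).card :=
      Finset.card_pos.2 ⟨j, by simp [hj]⟩
    exact_mod_cast this
  | succ n ih =>
    rw [fT, fT]
    apply Real.rpow_le_rpow (Finset.sum_nonneg fun j _ => fT_nonneg _ _ _ _) _ (by positivity)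
    refine Finset.sum_le_sum fun j hj => ih _ (by simpa using hj)

lemma fT_le {m : ℕ} (hm : 2 ≤ m) (q : ℕ+) (hq : 2 ≤ (q : ℕ)) (Ω : Set (ℕ+ → Fin m)) (n : ℕ)
    (u : List (Fin m)) :
    fT q Ω n u ≤ (m : ℝ) ^ ((1 : ℝ) / ((q : ℝ) - 1)) := by
  have hq' : (2 : ℝ) ≤ (q : ℝ) := by exact_mod_cast hq
  have hm' : (2 : ℝ) ≤ (m : ℝ) := by exact_mod_cast hm
  have hq1 : (0 : ℝ) < (q : ℝ) - 1 := by linarith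
  induction n generalizing u with
  | zero =>
    simp only [fT]
    exact Real.one_le_rpow (by linarith) (by positivity)
  | succ n ih =>
    have h1 : ∑ j ∈ Finset.univ.filter (fun j : Fin m => u ++ [j] ∈ Pref Ω),
      fT q Ω n (u ++ [j]) ≤ (m : ℝ) * (m : ℝ) ^ ((1 : ℝ) / ((q : ℝ) - 1)) := by
      calc _ ≤ ∑ j : Fin m, fT q Ω n (u ++ [j]) :=
            Finset.sum_le_sum_of_subset_of_nonneg (Finset.filter_subset _ _)
              (fun _ _ _ => fT_nonneg _ _ _ _)
        _ ≤ ∑ j : Fin m, (m : ℝ) ^ ((1 : ℝ) / ((q : ℝ) - 1)) :=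
            Finset.sum_le_sum fun j _ => ih _
        _ = _ := by simp
    have h2 : (m : ℝ) * (m : ℝ) ^ ((1 : ℝ) / ((q : ℝ) - 1)) =
        ((m : ℝ) ^ ((1 : ℝ) / ((q : ℝ) - 1))) ^ (q : ℝ) := by
      rw [← Real.rpow_mul (by linarith)]
      nth_rewrite 1 [← Real.rpow_one (m : ℝ)]
      rw [← Real.rpow_add (by linarith)]
      congr 1
      field_simp
      ring
    rw [fT]
    calc _ ≤ ((m : ℝ) * (m : ℝ) ^ ((1 : ℝ) / ((q : ℝ) - 1))) ^ ((1 : ℝ) / (q : ℝ)) :=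
          Real.rpow_le_rpow (Finset.sum_nonneg fun j _ => fT_nonneg _ _ _ _) h1 (by positivity)
      _ = _ := by
          rw [h2, ← Real.rpow_mul (by positivity), mul_one_div_cancel (by linarith),
            Real.rpow_one]

lemma exists_TSol {m : ℕ} (hm : 2 ≤ m) (q : ℕ+) (hq : 2 ≤ (q : ℕ)) (Ω : Set (ℕ+ → Fin m)) :
    ∃ t, TSol q Ω t := by
  have key : ∀ u ∈ Pref Ω, Monotone (fun n => fT q Ω n u) := fun u hu =>
    monotone_nat_of_le_succ fun n => fT_mono q Ω n u hu
  have hb : ∀ u, BddAbove (Set.range fun n => fT q Ω n u) := fun u =>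
    ⟨_, by rintro _ ⟨n, rfl⟩; exact fT_le hm q hq Ω n u⟩
  have hlim : ∀ u ∈ Pref Ω, Tendsto (fun n => fT q Ω n u) atTop (𝓝 (⨆ n, fT q Ω n u)) :=
    fun u hu => tendsto_atTop_ciSup (key u hu) (hb u)
  refine ⟨fun u => ⨆ n, fT q Ω n u, fun u hu => ⟨⟨?_, ?_⟩, ?_⟩⟩
  · exact le_ciSup_of_le (hb u) 0 (by simp [fT])
  · exact ciSup_le fun n => fT_le hm q hq Ω n u
  · have h1 : Tendsto (fun n => fT q Ω (n + 1) u ^ (q : ℕ)) atTop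
        (𝓝 ((⨆ n, fT q Ω n u) ^ (q : ℕ))) :=
      ((hlim u hu).comp (tendsto_add_atTop_nat 1)).pow _
    have h2 : Tendsto (fun n => fT q Ω (n + 1) u ^ (q : ℕ)) atTop
        (𝓝 (∑ j ∈ Finset.univ.filter (fun j : Fin m => u ++ [j] ∈ Pref Ω),
          ⨆ n, fT q Ω n (u ++ [j]))) := by
      have h3 : ∀ n, fT q Ω (n + 1) u ^ (q : ℕ) =
          ∑ j ∈ Finset.univ.filter (fun j : Fin m => u ++ [j] ∈ Pref Ω),
            fT q Ω n (u ++ [j]) := by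
        intro n
        rw [fT, ← Real.rpow_natCast, ← Real.rpow_mul
          (Finset.sum_nonneg fun j _ => fT_nonneg _ _ _ _), one_div_mul_cancel
          (by exact_mod_cast q.ne_zero), Real.rpow_one]
      simp_rw [h3]
      exact tendsto_finsetSum _ fun j hj => hlim _ (by simpa using hj)
    exact tendsto_nhds_unique h1 h2

/-- follow the choices `c` from the root -/
def pathC {m : ℕ} (c : List (Fin m) → Fin m) : ℕ → List (Fin m)
  | 0 => []
  | k + 1 => pathC c k ++ [c (pathC c k)]

/-- the infinite branch obtained by following the choices `c` -/
def branch {m : ℕ} (c : List (Fin m) → Fin m) : ℕ+ → Fin m := fun r => c (pathC c ((r : ℕ) - 1))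

lemma pre_branch {m : ℕ} (c : List (Fin m) → Fin m) (k : ℕ) : pre (branch c) k = pathC c k := by
  induction k with
  | zero => simp [pre, pathC]
  | succ k ih => rw [pre_succ, ih, pathC]; simp [branch]

lemma measurableSet_pathC {m : ℕ} (k : ℕ) (v : List (Fin m)) :
    MeasurableSet {c : List (Fin m) → Fin m | pathC c k = v} := by
  induction k generalizing v with
  | zero => simp [pathC]
  | succ k ih =>
    have : {c : List (Fin m) → Fin m | pathC c (k + 1) = v} =
        ⋃ v' : List (Fin m), {c | pathC c k = v'} ∩
          (fun c : List (Fin m) → Fin m => c v') ⁻¹' {j | v' ++ [j] = v} := by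
      ext c
      simp only [pathC, Set.mem_iUnion, Set.mem_inter_iff, Set.mem_preimage]
      constructor
      · intro h
        exact ⟨_, rfl, h⟩
      · rintro ⟨v', h1, h2⟩
        have h1' : pathC c k = v' := h1
        show pathC c k ++ [c (pathC c k)] = v
        rw [h1']; exact h2
    rw [this]
    exact MeasurableSet.iUnion fun v' =>
      (ih v').inter ((measurable_pi_apply v') (Set.toFinite _).measurableSet)

lemma measurable_branch {m : ℕ} : Measurable (branch (m := m)) := by
  rw [measurable_pi_iff]
  intro r
  refine measurable_to_countable' fun y => ?_
  have : (fun c : List (Fin m) → Fin m => branch c r) ⁻¹' {y} =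
        ⋃ v' : List (Fin m), {c | pathC c ((r : ℕ) - 1) = v'} ∩
          (fun c : List (Fin m) → Fin m => c v') ⁻¹' {y} := by
      ext c
      simp only [branch, Set.mem_iUnion, Set.mem_inter_iff, Set.mem_preimage]
      constructor
      · intro h
        exact ⟨_, rfl, h⟩
      · rintro ⟨v', h1, h2⟩
        have h1' : pathC c ((r : ℕ) - 1) = v' := h1
        rw [h1']; exact h2
  rw [this]
  exact MeasurableSet.iUnion fun v' =>
      (measurableSet_pathC _ v').inter ((measurable_pi_apply v') (measurableSet_singleton _))

lemma pathC_eq_iff {m : ℕ} (c : List (Fin m) → Fin m) (u : List (Fin m)) (k : ℕ)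
    (hk : k ≤ u.length) :
    pathC c k = u.take k ↔ ∀ i < k, u[i]? = some (c (u.take i)) := by
  induction k with
  | zero => simp [pathC]
  | succ k ih =>
    have hk' : k < u.length := hk
    have h1 : u.take (k + 1) = u.take k ++ [u[k]] := by simp
    have h2 : u[k]? = some u[k] := by simp
    rw [pathC, h1]
    constructor
    · intro h
      obtain ⟨ha, hb⟩ := List.append_inj' h rfl
      have hc := (ih hk'.le).1 ha
      intro i hi
      rcases Nat.lt_succ_iff_lt_or_eq.1 hi with h3 | rfl
      · exact hc i h3
      · rw [h2, ← ha]
        simp only [List.cons.injEq, and_true] at hb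
        rw [hb]
    · intro h
      have ha := (ih hk'.le).2 (fun i hi => h i (by omega))
      have hb := h k (by omega)
      rw [h2, Option.some.injEq] at hb
      rw [ha, hb]

lemma exists_CylVals {m : ℕ} (q : ℕ+) (Ω : Set (ℕ+ → Fin m)) (hne : Ω.Nonempty)
    (hcl : IsClosed Ω) (t : List (Fin m) → ℝ) (ht : TSol q Ω t) :
    ∃ μ : Measure (ℕ+ → Fin m), IsProbabilityMeasure μ ∧ μ Ω = 1 ∧ CylVals q Ω t μ := by
  obtain ⟨x0, hx0⟩ := hne
  let p : List (Fin m) → Fin m → ℝ := fun u j =>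
    if u ++ [j] ∈ Pref Ω then t (u ++ [j]) / t u ^ (q : ℕ) else 0
  have htpos : ∀ u ∈ Pref Ω, 0 < t u := fun u hu => lt_of_lt_of_le one_pos (ht u hu).1.1
  have hp0 : ∀ u j, 0 ≤ p u j := by
    intro u j
    simp only [p]
    split_ifs with h
    · exact div_nonneg (htpos _ h).le (pow_nonneg (htpos _ (pref_left h)).le _)
    · exact le_rfl
  have hp1 : ∀ u ∈ Pref Ω, ∑ j, p u j = 1 := by
    intro u hu
    simp only [p]
    rw [← Finset.sum_filter, ← Finset.sum_div, ← (ht u hu).2, div_self]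
    exact pow_ne_zero _ (htpos u hu).ne'
  let ν : List (Fin m) → Measure (Fin m) := fun u =>
    if u ∈ Pref Ω then ∑ j, ENNReal.ofReal (p u j) • Measure.dirac j else Measure.dirac (x0 1)
  have hνs : ∀ u ∈ Pref Ω, ∀ j, ν u {j} = ENNReal.ofReal (p u j) := by
    intro u hu j
    simp only [ν, if_pos hu, Measure.finsetSum_apply, Measure.smul_apply, smul_eq_mul,
      Measure.dirac_apply' _ (measurableSet_singleton j)]
    rw [Finset.sum_eq_single j]
    · simp
    · intro b _ hb
      simp [hb]
    · simp
  have hνp : ∀ u, IsProbabilityMeasure (ν u) := by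
    intro u
    by_cases hu : u ∈ Pref Ω
    · constructor
      simp only [ν, if_pos hu, Measure.finsetSum_apply, Measure.smul_apply, smul_eq_mul,
        measure_univ, mul_one]
      rw [← ENNReal.ofReal_sum_of_nonneg (fun j _ => hp0 u j), hp1 u hu, ENNReal.ofReal_one]
    · simp only [ν, if_neg hu]
      infer_instance
  let M := Measure.infinitePi ν
  refine ⟨M.map branch, Measure.isProbabilityMeasure_map measurable_branch.aemeasurable, ?_, ?_⟩
  · have hprob : IsProbabilityMeasure (M.map branch) :=
      Measure.isProbabilityMeasure_map measurable_branch.aemeasurable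
    rw [← mem_ae_iff_prob_eq_one hcl.measurableSet]
    rw [← Filter.eventually_mem_set, ae_map_iff (p := fun x => x ∈ Ω)
      measurable_branch.aemeasurable hcl.measurableSet]
    have h1 : ∀ᵐ c ∂M, ∀ u : List (Fin m), u ∈ Pref Ω → u ++ [c u] ∈ Pref Ω := by
      rw [ae_all_iff]
      intro u
      by_cases hu : u ∈ Pref Ω
      · have h2 : ∀ᵐ j ∂(ν u), u ++ [j] ∈ Pref Ω := by
          rw [ae_iff]
          have h3 : {j | u ++ [j] ∉ Pref Ω} = ⋃ j ∈ {j | u ++ [j] ∉ Pref Ω}, {j} :=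
            (Set.biUnion_of_singleton _).symm
          rw [h3, measure_biUnion_null_iff (Set.to_countable _)]
          intro j hj
          rw [hνs u hu]
          have hj' : u ++ [j] ∉ Pref Ω := hj
          simp [p, hj']
        have h4 := (measurePreserving_eval_infinitePi ν u).quasiMeasurePreserving.ae h2
        filter_upwards [h4] with c hc _ using hc
      · exact Eventually.of_forall fun c h => absurd h hu
    filter_upwards [h1] with c hc
    apply mem_of_pre hcl
    intro k
    rw [pre_branch]
    induction k with
    | zero => exact ⟨x0, hx0, by rw [begins_iff]; simp [pathC, pre]⟩
    | succ k ih => exact hc _ ih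
  · intro u hu
    rw [Measure.map_apply measurable_branch (measurableSet_Cyl u)]
    let F : Finset (List (Fin m)) := (Finset.range u.length).image (fun i => u.take i)
    let S : List (Fin m) → Set (Fin m) := fun w => {j | u[w.length]? = some j}
    have h1 : branch ⁻¹' (Cyl u) = Set.pi (F : Set (List (Fin m))) S := by
      ext c
      have h2 : c ∈ branch ⁻¹' (Cyl u) ↔ pathC c u.length = u.take u.length := by
        rw [List.take_length, ← pre_branch]
        exact begins_iff _ _
      rw [h2, pathC_eq_iff c u _ le_rfl]
      simp only [Set.mem_pi, F, Finset.coe_image, Set.forall_mem_image, Finset.coe_range,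
        Set.mem_Iio]
      refine forall_congr' fun i => forall_congr' fun hi => ?_
      show _ ↔ u[(u.take i).length]? = some _
      rw [List.length_take, min_eq_left hi.le]
    rw [h1, Measure.infinitePi_pi _ (fun _ _ => (Set.toFinite _).measurableSet)]
    rw [Finset.prod_image, ENNReal.ofReal_prod_of_nonneg]
    · refine Finset.prod_congr rfl fun i hi => ?_
      have hi' : i < u.length := Finset.mem_range.1 hi
      have h3 : S (u.take i) = {u[i]} := by
        ext j
        show u[(u.take i).length]? = some j ↔ j = u[i]
        rw [List.length_take, min_eq_left hi'.le]
        simp [hi', eq_comm]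
      have h4 : u.take (i + 1) = u.take i ++ [u[i]] := by simp
      have h5 : u.take (i + 1) ∈ Pref Ω := by
        apply pref_left (v := u.drop (i + 1)); simpa using hu
      rw [h3, hνs _ (pref_left (v := u.drop i) (by simpa using hu))]
      congr 1
      simp only [p]
      rw [← h4, if_pos h5]
    · intro i _
      have h5 : ∀ i, u.take i ∈ Pref Ω := fun i => by
        apply pref_left (v := u.drop i); simpa using hu
      exact div_nonneg (htpos _ (h5 _)).le (pow_nonneg (htpos _ (h5 _)).le _)
    · intro i hi j hj hij
      have := congrArg List.length hij
      simp only [Finset.coe_range, Set.mem_Iio] at hi hj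
      simp only [List.length_take] at this
      omega

lemma sOm_opt {m : ℕ} (hm : 2 ≤ m) (q : ℕ+) (hq : 2 ≤ (q : ℕ)) (Ω : Set (ℕ+ → Fin m))
    (hcl : IsClosed Ω) (t : List (Fin m) → ℝ) (ht : TSol q Ω t)
    (μ : Measure (ℕ+ → Fin m)) [IsProbabilityMeasure μ] (hμ : μ Ω = 1) (hc : CylVals q Ω t μ) :
    sOm m q μ = ((q : ℝ) - 1) * Real.logb m (t []) := by
  have hq' : (2 : ℝ) ≤ (q : ℝ) := by exact_mod_cast hq
  have hm' : (2 : ℝ) ≤ (m : ℝ) := by exact_mod_cast hm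
  have hq1 : (0 : ℝ) < (q : ℝ) - 1 := by linarith
  have htpos : ∀ u ∈ Pref Ω, 0 < t u := fun u hu => lt_of_lt_of_le one_pos (ht u hu).1.1
  have hae : ∀ᵐ x ∂μ, x ∈ Ω := (mem_ae_iff_prob_eq_one hcl.measurableSet).2 hμ
  -- pointwise values
  have hval : ∀ x ∈ Ω, ∀ k, (μ (Cyl (pre x k))).toReal =
      ∏ j ∈ Finset.range k, t (pre x (j + 1)) / t (pre x j) ^ (q : ℕ) := by
    intro x hx k
    rw [hc _ (pre_mem hx k), ENNReal.toReal_ofReal, pre_length]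
    · refine Finset.prod_congr rfl fun j hj => ?_
      have hj' := Finset.mem_range.1 hj
      rw [pre_take _ _ _ (by omega), pre_take _ _ _ (by omega)]
    · rw [pre_length]
      refine Finset.prod_nonneg fun j hj => ?_
      have hj' := Finset.mem_range.1 hj
      rw [pre_take _ _ _ (by omega), pre_take _ _ _ (by omega)]
      exact div_nonneg (htpos _ (pre_mem hx _)).le (pow_nonneg (htpos _ (pre_mem hx _)).le _)
  have hpos : ∀ x ∈ Ω, ∀ k, 0 < (μ (Cyl (pre x k))).toReal := by
    intro x hx k
    rw [hval x hx k]
    exact Finset.prod_pos fun j _ =>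
      div_pos (htpos _ (pre_mem hx _)) (pow_pos (htpos _ (pre_mem hx _)) _)
  let e : ℕ → ℝ := fun k => ∫ x, Real.logb m (t (pre x k)) ∂μ
  have hLogI : ∀ k, Integrable (fun x => Real.logb m (t (pre x k))) μ := fun k =>
    integrable_comp_pre μ k (fun u => Real.logb m (t u))
  have hYI : ∀ k, Integrable (fun x => Yinf μ k x) μ := fun k =>
    integrable_comp_pre μ k (fun u => - Real.logb m (μ (Cyl u)).toReal)
  have hrec : ∀ k, Hent m μ (k + 1) = Hent m μ k + q * e k - e (k + 1) := by
    intro k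
    rw [Hent_eq_integral, Hent_eq_integral]
    simp only [e]
    rw [← integral_const_mul, ← integral_add (hYI k) ((hLogI k).const_mul _),
      ← integral_sub (f := fun x => Yinf μ k x + q * Real.logb m (t (pre x k)))
        ((hYI k).add ((hLogI k).const_mul _)) (hLogI (k + 1))]
    refine integral_congr_ae ?_
    filter_upwards [hae] with x hx
    have h1 := hval x hx (k + 1)
    rw [Finset.prod_range_succ, ← hval x hx k] at h1
    simp only [Yinf]
    have ha := htpos _ (pre_mem hx k)
    have hb := htpos _ (pre_mem hx (k + 1))
    rw [h1, Real.logb_mul (hpos x hx k).ne' (by positivity), Real.logb_div hb.ne' (by positivity),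
      Real.logb_pow]
    ring
  have hH0 : Hent m μ 0 = 0 := by
    have : ∀ u : List (Fin m), u = [] → (μ (Cyl u)) = 1 := by
      rintro _ rfl
      have : Cyl ([] : List (Fin m)) = Set.univ := by
        ext x
        simp [Cyl, Begins]
      rw [this, measure_univ]
    simp [Hent, this]
  have he0 : e 0 = Real.logb m (t []) := by
    have : ∀ x : ℕ+ → Fin m, pre x 0 = [] := fun x => by simp [pre]
    simp [e, this]
  have hTb : ∀ x ∈ Ω, ∀ k, 0 ≤ Real.logb m (t (pre x k)) ∧
      Real.logb m (t (pre x k)) ≤ 1 / ((q : ℝ) - 1) := by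
    intro x hx k
    have h1 := (ht _ (pre_mem hx k)).1
    refine ⟨Real.logb_nonneg (by linarith) h1.1, ?_⟩
    rw [Real.logb_le_iff_le_rpow (by linarith) (htpos _ (pre_mem hx k))]
    exact h1.2
  have he_nonneg : ∀ k, 0 ≤ e k := fun k =>
    integral_nonneg_of_ae (by filter_upwards [hae] with x hx using (hTb x hx k).1)
  have he_le : ∀ k, e k ≤ 1 / ((q : ℝ) - 1) := by
    intro k
    have : ∫ x, Real.logb m (t (pre x k)) ∂μ ≤ ∫ x, 1 / ((q : ℝ) - 1) ∂μ :=
      integral_mono_ae (hLogI k) (integrable_const _)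
        (by filter_upwards [hae] with x hx using (hTb x hx k).2)
    simpa [e] using this
  have hH_nonneg : ∀ k, 0 ≤ Hent m μ k := by
    intro k
    rw [Hent_eq_integral]
    refine integral_nonneg fun x => ?_
    simp only [Yinf, Pi.zero_apply, Left.nonneg_neg_iff]
    refine Real.logb_nonpos (by linarith) ENNReal.toReal_nonneg ?_
    exact measureReal_le_one (μ := μ)
  have hH_le : ∀ k, Hent m μ k ≤ k * (q * (1 / ((q : ℝ) - 1))) := by
    intro k
    induction k with
    | zero => simp [hH0]
    | succ k ih =>
      rw [hrec]
      have := mul_le_mul_of_nonneg_left (he_le k) (by linarith : (0 : ℝ) ≤ q)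
      have := he_nonneg (k + 1)
      push_cast
      linarith
  -- partial sums
  have hpart : ∀ K : ℕ, ((q : ℝ) - 1) * ∑ k ∈ Finset.range K, Hent m μ (k + 1) / (q : ℝ) ^ (k + 2)
      = e 0 - e K / (q : ℝ) ^ K - Hent m μ K / (q : ℝ) ^ (K + 1) := by
    intro K
    induction K with
    | zero => simp [hH0]
    | succ K ih =>
      rw [Finset.sum_range_succ, mul_add, ih, hrec K]
      field_simp
      ring
  have hqinv : |(q : ℝ)⁻¹| < 1 := by
    rw [abs_of_pos (by positivity)]
    exact inv_lt_one_of_one_lt₀ (by linarith)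
  have hlimq : Tendsto (fun K : ℕ => ((q : ℝ)⁻¹) ^ K) atTop (𝓝 0) :=
    tendsto_pow_atTop_nhds_zero_of_abs_lt_one hqinv
  have hlimq2 : Tendsto (fun K : ℕ => (K : ℝ) * ((q : ℝ)⁻¹) ^ K) atTop (𝓝 0) :=
    tendsto_self_mul_const_pow_of_abs_lt_one hqinv
  have hl1 : Tendsto (fun K => e K / (q : ℝ) ^ K) atTop (𝓝 0) := by
    refine squeeze_zero (fun K => div_nonneg (he_nonneg K) (by positivity)) (fun K => ?_)
      (by simpa using hlimq.const_mul (1 / ((q : ℝ) - 1)))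
    rw [div_eq_mul_inv, ← inv_pow]
    gcongr
    simpa using he_le K
  have hl2 : Tendsto (fun K => Hent m μ K / (q : ℝ) ^ (K + 1)) atTop (𝓝 0) := by
    refine squeeze_zero (fun K => div_nonneg (hH_nonneg K) (by positivity)) (fun K => ?_)
      (by simpa using hlimq2.const_mul ((q : ℝ) * (1 / ((q : ℝ) - 1)) * (q : ℝ)⁻¹))
    rw [div_eq_mul_inv, ← inv_pow]
    calc _ ≤ (K * (q * (1 / ((q : ℝ) - 1)))) * (q : ℝ)⁻¹ ^ (K + 1) := by
          gcongr
          exact hH_le K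
      _ = _ := by rw [pow_succ]; ring
  have hsum : HasSum (fun k : ℕ => Hent m μ (k + 1) / (q : ℝ) ^ (k + 2))
      (e 0 / ((q : ℝ) - 1)) := by
    rw [hasSum_iff_tendsto_nat_of_nonneg
      (fun k => div_nonneg (hH_nonneg _) (by positivity))]
    have h1 : ∀ K : ℕ, ∑ k ∈ Finset.range K, Hent m μ (k + 1) / (q : ℝ) ^ (k + 2) =
        (e 0 - e K / (q : ℝ) ^ K - Hent m μ K / (q : ℝ) ^ (K + 1)) / ((q : ℝ) - 1) := by
      intro K
      rw [← hpart K]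
      field_simp
    simp_rw [h1]
    simpa using ((hl1.const_sub (e 0)).sub hl2).div_const ((q : ℝ) - 1)
  rw [sOm, hsum.tsum_eq, he0]
  field_simp

lemma ValMap_eq {m : ℕ} (x : ℕ+ → Fin m) :
    ValMap m x = Real.ofDigits (fun k : ℕ => x ⟨k + 1, Nat.succ_pos _⟩) := by
  unfold ValMap Real.ofDigits
  have := tsum_pnat_eq_tsum_succ (f := fun k : ℕ => ((x ⟨(k - 1) + 1, Nat.succ_pos _⟩ : ℕ) : ℝ) *
    (m : ℝ)⁻¹ ^ k)
  have h2 : ∀ k : ℕ+, (⟨((k : ℕ) - 1) + 1, Nat.succ_pos _⟩ : ℕ+) = k := by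
    intro k; apply PNat.eq; have := k.pos; simp; omega
  simp only [h2] at this
  rw [this]
  refine tsum_congr fun k => ?_
  simp [Real.ofDigitsTerm]

/-- word of `x` along the geometric progression up to `r` -/
def tw {m : ℕ} (q : ℕ) (x : ℕ → Fin m) (r : ℕ) : List (Fin m) :=
  if h : q ∣ r ∧ 0 < r ∧ 2 ≤ q then tw q x (r / q) ++ [x r] else [x r]
termination_by r
decreasing_by exact Nat.div_lt_self h.2.1 h.2.2

/-- word of `x` along the geometric progression strictly before `r` -/
def par {m : ℕ} (q : ℕ) (x : ℕ → Fin m) (r : ℕ) : List (Fin m) :=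
  if q ∣ r ∧ 0 < r ∧ 2 ≤ q then tw q x (r / q) else []

lemma tw_eq {m : ℕ} (q : ℕ) (x : ℕ → Fin m) (r : ℕ) : tw q x r = par q x r ++ [x r] := by
  rw [tw, par]
  split_ifs <;> simp

lemma tw_congr {m : ℕ} (q : ℕ) (x y : ℕ → Fin m) (r : ℕ) (hr : 0 < r)
    (h : ∀ s, 0 < s → s ≤ r → x s = y s) : tw q x r = tw q y r := by
  induction r using Nat.strong_induction_on with
  | _ r ih =>
    rw [tw_eq, tw_eq, h r hr le_rfl, par, par]
    split_ifs with hq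
    · have h1 : 0 < r / q := Nat.div_pos (Nat.le_of_dvd hr hq.1) (by omega)
      have h2 : r / q < r := Nat.div_lt_self hr hq.2.2
      rw [ih (r / q) h2 h1 (fun s hs hs' => h s hs (by omega))]
    · rfl

lemma par_congr {m : ℕ} (q : ℕ) (x y : ℕ → Fin m) (r : ℕ) (hr : 0 < r)
    (h : ∀ s, 0 < s → s < r → x s = y s) : par q x r = par q y r := by
  rw [par, par]
  split_ifs with hq
  · have h1 : 0 < r / q := Nat.div_pos (Nat.le_of_dvd hr hq.1) (by omega)
    have h2 : r / q < r := Nat.div_lt_self hr hq.2.2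
    exact tw_congr q x y _ h1 (fun s hs hs' => h s hs (by omega))
  · rfl

lemma tw_pow {m : ℕ} (q : ℕ) (hq : 2 ≤ q) (x : ℕ → Fin m) (i : ℕ) (hi : 0 < i) (hqi : ¬ q ∣ i)
    (l : ℕ) : tw q x (q ^ l * i) = List.ofFn (fun j : Fin (l + 1) => x (q ^ (j : ℕ) * i)) := by
  induction l with
  | zero => rw [tw]; simp [hqi]
  | succ l ih =>
    have h1 : q ∣ q ^ (l + 1) * i := Dvd.dvd.mul_right (dvd_pow_self q (by omega)) i
    have h2 : q ^ (l + 1) * i / q = q ^ l * i := by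
      rw [pow_succ', mul_assoc, Nat.mul_div_cancel_left _ (by omega)]
    rw [tw, dif_pos ⟨h1, by positivity, hq⟩, h2, ih, List.ofFn_succ_last (n := l + 1)]
    simp

/-- sequence indexed by `ℕ` (the value at `0` is irrelevant) -/
def sqx {m : ℕ} (x : ℕ+ → Fin m) (r : ℕ) : Fin m := x ⟨(r - 1) + 1, Nat.succ_pos _⟩

lemma tw_mem {m : ℕ} (q : ℕ+) (hq : 2 ≤ (q : ℕ)) (Ω : Set (ℕ+ → Fin m)) (x : ℕ+ → Fin m)
    (hx : x ∈ XOm q Ω) (r : ℕ) (hr : 0 < r) : tw q (sqx x) r ∈ Pref Ω := by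
  obtain ⟨l, i, hi, rfl⟩ := Nat.exists_eq_pow_mul_and_not_dvd (n := r) (by omega) (q : ℕ) (by omega)
  have hi0 : 0 < i := by
    rcases Nat.eq_zero_or_pos i with h | h
    · subst h; simp at hi
    · exact h
  have h1 : RestrJ q x (⟨i, hi0⟩ : ℕ+) ∈ Ω := hx (⟨i, hi0⟩ : ℕ+) (fun h => hi (PNat.dvd_iff.1 h))
  have h2 := pre_mem h1 (l + 1)
  rw [tw_pow _ hq _ _ hi0 hi]
  convert h2 using 1
  unfold pre
  congr 1
  funext j
  simp only [sqx, RestrJ]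
  congr 1
  apply PNat.eq
  have h3 : 0 < (q : ℕ) ^ (j : ℕ) * i := by positivity
  have h4 : ∀ i' : ℕ+, (i' : ℕ) = i →
      ((q ^ ((j : ℕ) + 1 - 1) * i' : ℕ+) : ℕ) = (q : ℕ) ^ (j : ℕ) * i := by
    intro i' hi'
    rw [PNat.mul_coe, PNat.pow_coe, Nat.add_sub_cancel, hi']
  exact (Nat.sub_add_cancel h3).trans (h4 _ rfl).symm

/-- conditional weights -/
def gW {m : ℕ} (q : ℕ) (Ω : Set (ℕ+ → Fin m)) (t : List (Fin m) → ℝ) (u : List (Fin m)) : ℝ :=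
  if u ∈ Pref Ω then t u / t u.dropLast ^ q else 0

/-- weights of prefixes -/
def WW {m : ℕ} (q : ℕ) (Ω : Set (ℕ+ → Fin m)) (t : List (Fin m) → ℝ) (x : ℕ → Fin m) (n : ℕ) : ℝ :=
  ∏ r ∈ Finset.range n, gW q Ω t (tw q x (r + 1))

lemma gW_nonneg {m : ℕ} (q : ℕ+) (Ω : Set (ℕ+ → Fin m)) (t : List (Fin m) → ℝ)
    (ht : TSol q Ω t) (u : List (Fin m)) : 0 ≤ gW q Ω t u := by
  have htpos : ∀ u ∈ Pref Ω, 0 < t u := fun u hu => lt_of_lt_of_le one_pos (ht u hu).1.1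
  unfold gW
  split_ifs with h
  · have h2 : u.dropLast ∈ Pref Ω := by
      rw [List.dropLast_eq_take]
      exact pref_left (v := u.drop (u.length - 1)) (by simpa using h)
    exact div_nonneg (htpos _ h).le (pow_nonneg (htpos _ h2).le _)
  · exact le_rfl

lemma WW_nonneg {m : ℕ} (q : ℕ+) (Ω : Set (ℕ+ → Fin m)) (t : List (Fin m) → ℝ)
    (ht : TSol q Ω t) (x : ℕ → Fin m) (n : ℕ) : 0 ≤ WW q Ω t x n :=
  Finset.prod_nonneg fun _ _ => gW_nonneg q Ω t ht _

lemma gW_sum {m : ℕ} (q : ℕ+) (Ω : Set (ℕ+ → Fin m)) (t : List (Fin m) → ℝ)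
    (ht : TSol q Ω t) (u : List (Fin m)) : ∑ j, gW q Ω t (u ++ [j]) ≤ 1 := by
  by_cases hu : u ∈ Pref Ω
  · have h0 : 0 < t u := lt_of_lt_of_le one_pos (ht u hu).1.1
    simp only [gW, List.dropLast_concat]
    rw [← Finset.sum_filter, ← Finset.sum_div, ← (ht u hu).2, div_self]
    exact pow_ne_zero _ h0.ne'
  · rw [Finset.sum_eq_zero]
    · exact zero_le_one
    · intro j _
      rw [gW, if_neg]
      exact fun h => hu (pref_left h)

/-- extend a finite word by a constant -/
def extW {m : ℕ} (a : Fin m) {n : ℕ} (v : Fin n → Fin m) (r : ℕ) : Fin m :=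
  if h : r - 1 < n then v ⟨r - 1, h⟩ else a

lemma WW_congr {m : ℕ} (q : ℕ) (Ω : Set (ℕ+ → Fin m)) (t : List (Fin m) → ℝ)
    (x y : ℕ → Fin m) (n : ℕ) (h : ∀ s, 0 < s → s ≤ n → x s = y s) :
    WW q Ω t x n = WW q Ω t y n := by
  refine Finset.prod_congr rfl fun r hr => ?_
  have := Finset.mem_range.1 hr
  rw [tw_congr q x y (r + 1) (by omega) (fun s hs hs' => h s hs (by omega))]

lemma WW_sum {m : ℕ} (q : ℕ+) (Ω : Set (ℕ+ → Fin m)) (t : List (Fin m) → ℝ)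
    (ht : TSol q Ω t) (a : Fin m) (n : ℕ) :
    ∑ v : Fin n → Fin m, WW q Ω t (extW a v) n ≤ 1 := by
  induction n with
  | zero => simp [WW]
  | succ n ih =>
    rw [← (Fin.snocEquiv (fun _ : Fin (n + 1) => Fin m)).sum_comp, Fintype.sum_prod_type_right]
    refine le_trans (Finset.sum_le_sum fun v _ => ?_) ih
    have h1 : ∀ (j : Fin m) (s : ℕ), 0 < s → s ≤ n →
        extW a (Fin.snocEquiv (fun _ : Fin (n + 1) => Fin m) (j, v)) s = extW a v s := by
      intro j s hs hs'
      have ha : s - 1 < n := by omega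
      have hb : s - 1 < n + 1 := by omega
      simp only [extW, ha, hb, dif_pos, Fin.snocEquiv]
      exact Fin.snoc_castSucc (α := fun _ => Fin m) j v ⟨s - 1, ha⟩
    have h2 : ∀ (j : Fin m),
        extW a (Fin.snocEquiv (fun _ : Fin (n + 1) => Fin m) (j, v)) (n + 1) = j := by
      intro j
      simp only [extW, Fin.snocEquiv]
      rw [dif_pos (by omega)]
      exact Fin.snoc_last (α := fun _ => Fin m) j v
    have h3 : ∀ j : Fin m, WW q Ω t
        (extW a (Fin.snocEquiv (fun _ : Fin (n + 1) => Fin m) (j, v))) (n + 1) =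
        WW q Ω t (extW a v) n * gW q Ω t (par q (extW a v) (n + 1) ++ [j]) := by
      intro j
      rw [WW, Finset.prod_range_succ, tw_eq, h2,
        par_congr q _ (extW a v) (n + 1) (by omega) (fun s hs hs' => h1 j s hs (by omega))]
      congr 1
      exact WW_congr q Ω t _ _ n (h1 j)
    simp_rw [h3]
    rw [← Finset.mul_sum]
    exact mul_le_of_le_one_right (WW_nonneg q Ω t ht _ _) (gW_sum q Ω t ht _)

lemma sum_par {m : ℕ} (q : ℕ) (hq : 2 ≤ q) (x : ℕ → Fin m) (T : List (Fin m) → ℝ) (n : ℕ) :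
    ∑ r ∈ Finset.range (q * n), T (par q x (r + 1)) =
      ∑ r ∈ Finset.range n, T (tw q x (r + 1)) + ((q : ℝ) * n - n) * T [] := by
  induction n with
  | zero => simp
  | succ n ih =>
    obtain ⟨p, rfl⟩ : ∃ p, q = p + 1 := ⟨q - 1, by omega⟩
    rw [mul_add, mul_one, Finset.sum_range_add, ih, Finset.sum_range_succ,
      Finset.sum_range_succ (n := n)]
    have h1 : ∑ r ∈ Finset.range p, T (par (p + 1) x ((p + 1) * n + r + 1)) = p * T [] := by
      rw [Finset.sum_congr rfl (g := fun _ => T [])]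
      · simp
      · intro r hr
        have hr' := Finset.mem_range.1 hr
        rw [par, if_neg]
        rintro ⟨h, -⟩
        rw [add_assoc, Nat.dvd_add_right (Dvd.intro _ rfl)] at h
        have := Nat.le_of_dvd (by omega) h
        omega
    have h2 : par (p + 1) x ((p + 1) * n + p + 1) = tw (p + 1) x (n + 1) := by
      have h3 : (p + 1) * n + p + 1 = (p + 1) * (n + 1) := by ring
      rw [h3, par, if_pos ⟨Dvd.intro _ rfl, by positivity, hq⟩, Nat.mul_div_cancel_left _ (by omega)]
    rw [h1, h2]
    push_cast
    ring

lemma WW_frequently {m : ℕ} (hm : 2 ≤ m) (q : ℕ+) (hq : 2 ≤ (q : ℕ)) (Ω : Set (ℕ+ → Fin m))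
    (t : List (Fin m) → ℝ) (ht : TSol q Ω t) (x : ℕ+ → Fin m) (hx : x ∈ XOm q Ω)
    (θ : ℝ) (hθ : ((q : ℝ) - 1) * Real.logb m (t []) < θ) (N : ℕ) :
    ∃ k, N ≤ k ∧ (m : ℝ) ^ (-(θ * ((q : ℕ) ^ (k + 1) : ℕ))) ≤
      WW q Ω t (sqx x) ((q : ℕ) ^ (k + 1)) := by
  have hq' : (2 : ℝ) ≤ ((q : ℕ) : ℝ) := by exact_mod_cast hq
  have hm' : (2 : ℝ) ≤ (m : ℝ) := by exact_mod_cast hm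
  have htpos : ∀ u ∈ Pref Ω, 0 < t u := fun u hu => lt_of_lt_of_le one_pos (ht u hu).1.1
  have hmem : ∀ r, tw q (sqx x) (r + 1) ∈ Pref Ω := fun r => tw_mem q hq Ω x hx _ (by omega)
  have hmem' : ∀ r, par q (sqx x) (r + 1) ∈ Pref Ω := fun r => by
    have := hmem r
    rw [tw_eq] at this
    exact pref_left this
  let T : List (Fin m) → ℝ := fun u => Real.logb m (t u)
  have hg : ∀ r, gW q Ω t (tw q (sqx x) (r + 1)) =
      t (tw q (sqx x) (r + 1)) / t (par q (sqx x) (r + 1)) ^ (q : ℕ) := by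
    intro r
    rw [gW, if_pos (hmem r)]
    congr 3
    rw [tw_eq, List.dropLast_concat]
  have hgpos : ∀ r, 0 < gW q Ω t (tw q (sqx x) (r + 1)) := fun r => by
    rw [hg]; exact div_pos (htpos _ (hmem r)) (pow_pos (htpos _ (hmem' r)) _)
  have hWpos : ∀ n, 0 < WW q Ω t (sqx x) n := fun n => Finset.prod_pos fun r _ => hgpos r
  let S : ℕ → ℝ := fun n => ∑ r ∈ Finset.range n, T (tw q (sqx x) (r + 1))
  have hS0 : ∀ n, 0 ≤ S n := fun n => Finset.sum_nonneg fun r _ =>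
    Real.logb_nonneg (by linarith) (ht _ (hmem r)).1.1
  have hlog : ∀ n, Real.logb m (WW q Ω t (sqx x) ((q : ℕ) * n)) =
      S ((q : ℕ) * n) - (q : ℕ) * (S n + (((q : ℕ) : ℝ) * n - n) * T []) := by
    intro n
    rw [← sum_par (q : ℕ) hq (sqx x) T n, WW, Real.logb_prod _ _ (fun r _ => (hgpos r).ne'),
      Finset.mul_sum, ← Finset.sum_sub_distrib]
    refine Finset.sum_congr rfl fun r _ => ?_
    rw [hg, Real.logb_div (htpos _ (hmem r)).ne' (pow_pos (htpos _ (hmem' r)) _).ne',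
      Real.logb_pow]
  by_contra hcon
  push Not at hcon
  let a : ℕ → ℝ := fun k => S ((q : ℕ) ^ k) / ((q : ℕ) : ℝ) ^ k
  set s := (((q : ℕ) : ℝ) - 1) * Real.logb m (t []) with hs
  have hstep : ∀ k, N ≤ k → a (k + 1) ≤ a k - (θ - s) := by
    intro k hk
    have h1 := hcon k hk
    have h2 : Real.logb m (WW q Ω t (sqx x) ((q : ℕ) ^ (k + 1))) <
        -(θ * ((q : ℕ) ^ (k + 1) : ℕ)) := by
      rw [Real.logb_lt_iff_lt_rpow (by linarith) (hWpos _)]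
      exact h1
    rw [pow_succ', hlog] at h2
    have hQ : (0 : ℝ) < ((q : ℕ) : ℝ) ^ k := by positivity
    have h3 : a (k + 1) * ((q : ℕ) : ℝ) ^ (k + 1) = S ((q : ℕ) ^ (k + 1)) := by
      simp only [a]; field_simp
    have h4 : a k * ((q : ℕ) : ℝ) ^ k = S ((q : ℕ) ^ k) := by
      simp only [a]; field_simp
    rw [← pow_succ', ← h3, ← h4] at h2
    push_cast at h2
    have h5 : (a (k + 1) - (a k - (θ - s))) * ((q : ℕ) : ℝ) ^ (k + 1) < 0 := by
      rw [hs]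
      have : T [] = Real.logb m (t []) := rfl
      rw [← this]
      rw [pow_succ'] at h2 ⊢
      nlinarith
    have h6 : (0 : ℝ) < ((q : ℕ) : ℝ) ^ (k + 1) := by positivity
    by_contra h7
    push Not at h7
    have := mul_nonneg (sub_nonneg.2 h7.le) h6.le
    linarith
  have hiter : ∀ n : ℕ, a (N + n) ≤ a N - n * (θ - s) := by
    intro n
    induction n with
    | zero => simp
    | succ n ih =>
      have := hstep (N + n) (by omega)
      rw [← add_assoc]
      push_cast
      linarith
  have ha0 : ∀ k, 0 ≤ a k := fun k => div_nonneg (hS0 _) (by positivity)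
  have hθ' : 0 < θ - s := sub_pos.2 hθ
  obtain ⟨n, hn⟩ := exists_nat_gt (a N / (θ - s))
  rw [div_lt_iff₀ hθ'] at hn
  have := hiter n
  have := ha0 (N + n)
  linarith

lemma dimH_upper {m : ℕ} (hm : 2 ≤ m) (q : ℕ+) (hq : 2 ≤ (q : ℕ)) (Ω : Set (ℕ+ → Fin m))
    (hne : Ω.Nonempty) (t : List (Fin m) → ℝ) (ht : TSol q Ω t) :
    dimH (XiSet (XOm q Ω)) ≤ ENNReal.ofReal (((q : ℝ) - 1) * Real.logb m (t [])) := by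
  obtain ⟨x0, hx0⟩ := hne
  have hq' : (2 : ℝ) ≤ ((q : ℕ) : ℝ) := by exact_mod_cast hq
  have hm' : (2 : ℝ) ≤ (m : ℝ) := by exact_mod_cast hm
  have hm0 : (0 : ℝ) < m := by linarith
  have hnil : ([] : List (Fin m)) ∈ Pref Ω := ⟨x0, hx0, by rw [begins_iff]; simp [pre]⟩
  set s := ((q : ℝ) - 1) * Real.logb m (t []) with hs
  have hs0 : 0 ≤ s := mul_nonneg (by linarith) (Real.logb_nonneg (by linarith) (ht _ hnil).1.1)
  by_contra hcon
  push Not at hcon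
  obtain ⟨d, hd1, hd2⟩ := ENNReal.lt_iff_exists_nnreal_btwn.1 hcon
  refine absurd hd2 (not_lt.2 (dimH_le_of_hausdorffMeasure_ne_top ?_))
  have hsd : s < d := by
    have := (ENNReal.ofReal_lt_iff_lt_toReal hs0 ENNReal.coe_ne_top).1 hd1
    simpa using this
  obtain ⟨θ, hθ1, hθ2⟩ := exists_between hsd
  let a : Fin m := x0 1
  let ρ : ℝ := (m : ℝ) ^ (-((d : ℝ) - θ))
  have hρ0 : 0 < ρ := Real.rpow_pos_of_pos hm0 _
  have hρ1 : ρ < 1 := Real.rpow_lt_one_of_one_lt_of_neg (by linarith) (by linarith)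
  let L : ℕ → ℕ → ℕ := fun N k => (q : ℕ) ^ (k + N + 1)
  have hLk : ∀ N k, k ≤ L N k := fun N k => by
    have : k + N + 1 < (q : ℕ) ^ (k + N + 1) := Nat.lt_pow_self (by omega)
    simp only [L]; omega
  have hLN : ∀ N k, N ≤ L N k := fun N k => by
    have : k + N + 1 < (q : ℕ) ^ (k + N + 1) := Nat.lt_pow_self (by omega)
    simp only [L]; omega
  let C : ∀ N : ℕ, (Σ k : ℕ, (Fin (L N k) → Fin m)) → Set ℝ := fun N p =>
    if (m : ℝ) ^ (-(θ * (L N p.1 : ℕ))) ≤ WW q Ω t (extW a p.2) (L N p.1) then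
      {z | ∃ x : ℕ+ → Fin m, (∀ j : Fin (L N p.1), x ⟨(j : ℕ) + 1, Nat.succ_pos _⟩ = p.2 j) ∧
        z = ValMap m x}
    else ∅
  have hdiam : ∀ N p, Metric.ediam (C N p) ≤ ENNReal.ofReal (((m : ℝ) ^ (L N p.1))⁻¹) := by
    intro N p
    simp only [C]
    split_ifs
    · refine Metric.ediam_le ?_
      rintro _ ⟨x, hx, rfl⟩ _ ⟨y, hy, rfl⟩
      rw [edist_dist]
      refine ENNReal.ofReal_le_ofReal ?_
      rw [Real.dist_eq, ValMap_eq, ValMap_eq]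
      refine Real.abs_ofDigits_sub_ofDigits_le fun i hi => ?_
      rw [hx ⟨i, hi⟩, hy ⟨i, hi⟩]
    · simp
  have hterm : ∀ N p, Metric.ediam (C N p) ^ (d : ℝ) ≤
      ENNReal.ofReal (ρ ^ (L N p.1) * WW q Ω t (extW a p.2) (L N p.1)) := by
    intro N p
    by_cases hgood : (m : ℝ) ^ (-(θ * (L N p.1 : ℕ))) ≤ WW q Ω t (extW a p.2) (L N p.1)
    · refine (ENNReal.rpow_le_rpow (hdiam N p) d.coe_nonneg).trans ?_
      rw [ENNReal.ofReal_rpow_of_nonneg (by positivity) d.coe_nonneg]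
      refine ENNReal.ofReal_le_ofReal ?_
      refine le_trans (le_of_eq ?_) (mul_le_mul_of_nonneg_left hgood (by positivity))
      simp only [ρ]
      rw [← Real.rpow_natCast, ← Real.rpow_natCast, ← Real.rpow_mul hm0.le, ← Real.rpow_neg hm0.le,
        ← Real.rpow_mul hm0.le, ← Real.rpow_add hm0]
      congr 1
      ring
    · have : C N p = ∅ := by simp only [C]; rw [if_neg hgood]
      rw [this, Metric.ediam_empty, ENNReal.zero_rpow_of_pos (by linarith)]
      exact zero_le
  have hsum : ∀ N, ∑' p, Metric.ediam (C N p) ^ (d : ℝ) ≤ (1 - ENNReal.ofReal ρ)⁻¹ := by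
    intro N
    rw [ENNReal.tsum_sigma', ← ENNReal.tsum_geometric]
    refine ENNReal.tsum_le_tsum fun k => ?_
    rw [tsum_fintype]
    calc ∑ v, Metric.ediam (C N ⟨k, v⟩) ^ (d : ℝ)
        ≤ ∑ v : Fin (L N k) → Fin m, ENNReal.ofReal (ρ ^ (L N k) * WW q Ω t (extW a v) (L N k)) :=
          Finset.sum_le_sum fun v _ => hterm N ⟨k, v⟩
      _ = ENNReal.ofReal (ρ ^ (L N k) * ∑ v : Fin (L N k) → Fin m, WW q Ω t (extW a v) (L N k)) := by
          rw [Finset.mul_sum, ENNReal.ofReal_sum_of_nonneg]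
          exact fun v _ => mul_nonneg (by positivity) (WW_nonneg q Ω t ht _ _)
      _ ≤ ENNReal.ofReal (ρ ^ k) := by
          refine ENNReal.ofReal_le_ofReal ?_
          refine (mul_le_of_le_one_right (by positivity) (WW_sum q Ω t ht a _)).trans ?_
          exact pow_le_pow_of_le_one hρ0.le hρ1.le (hLk N k)
      _ = _ := ENNReal.ofReal_pow hρ0.le k
  have hmain := Measure.hausdorffMeasure_le_liminf_tsum (d : ℝ) (XiSet (XOm q Ω)) (l := atTop)
    (fun N : ℕ => ENNReal.ofReal (((m : ℝ) ^ N)⁻¹)) ?_ C ?_ ?_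
  · refine ne_top_of_le_ne_top ?_ (hmain.trans (liminf_le_of_le (a := (1 - ENNReal.ofReal ρ)⁻¹) ?_ ?_))
    · refine ENNReal.inv_ne_top.2 ?_
      refine (tsub_pos_of_lt ?_).ne'
      simpa using hρ1
    · isBoundedDefault
    · intro b hb
      obtain ⟨N, hN⟩ := hb.exists
      exact hN.trans (hsum N)
  · rw [← ENNReal.ofReal_zero]
    refine ENNReal.tendsto_ofReal ?_
    simp_rw [← inv_pow]
    exact tendsto_pow_atTop_nhds_zero_of_lt_one (by positivity)
      (inv_lt_one_of_one_lt₀ (by linarith))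
  · refine Eventually.of_forall fun N p => (hdiam N p).trans (ENNReal.ofReal_le_ofReal ?_)
    gcongr
    · linarith
    · exact hLN N p.1
  · refine Eventually.of_forall fun N => ?_
    rintro _ ⟨x, hx, rfl⟩
    obtain ⟨k, hk, hkW⟩ := WW_frequently hm q hq Ω t ht x hx θ hθ1 N
    obtain ⟨k, rfl⟩ : ∃ k', k = k' + N := ⟨k - N, by omega⟩
    rw [Set.mem_iUnion]
    refine ⟨⟨k, fun j => x ⟨(j : ℕ) + 1, Nat.succ_pos _⟩⟩, ?_⟩
    simp only [C]
    rw [if_pos]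
    · exact ⟨x, fun j => rfl, rfl⟩
    · refine hkW.trans (le_of_eq ?_)
      refine WW_congr q Ω t _ _ _ fun r hr hr' => ?_
      have : r - 1 < L N k := by simp only [L]; omega
      simp only [sqx, extW]
      rw [dif_pos this]

/-- integer formed by the first `n` digits -/
def dig {m : ℕ} (x : ℕ+ → Fin m) : ℕ → ℕ
  | 0 => 0
  | n + 1 => m * dig x n + (x ⟨n + 1, Nat.succ_pos _⟩ : ℕ)

lemma dig_inj {m : ℕ} (x y : ℕ+ → Fin m) (n : ℕ) (h : dig x n = dig y n) :
    x ∈ CylN n y := by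
  induction n with
  | zero =>
    intro k hk
    have := k.pos
    omega
  | succ n ih =>
    simp only [dig] at h
    have hx := (x ⟨n + 1, Nat.succ_pos _⟩).2
    have hy := (y ⟨n + 1, Nat.succ_pos _⟩).2
    have hm0 : 0 < m := by omega
    have h1 : dig x n = dig y n := by
      have := congrArg (· / m) h
      simpa [Nat.mul_add_div hm0, Nat.div_eq_of_lt hx, Nat.div_eq_of_lt hy] using this
    have h2 : (x ⟨n + 1, Nat.succ_pos _⟩ : ℕ) = (y ⟨n + 1, Nat.succ_pos _⟩ : ℕ) := by
      rw [h1] at h; omega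
    intro k hk
    rcases Nat.lt_or_ge n (k : ℕ) with h3 | h3
    · have h4 : k = ⟨n + 1, Nat.succ_pos _⟩ := PNat.eq (by simp; omega)
      rw [h4]; exact Fin.ext h2
    · exact ih h1 k h3

lemma dig_val {m : ℕ} (hm : 2 ≤ m) (x : ℕ+ → Fin m) (n : ℕ) :
    (dig x n : ℝ) ≤ (m : ℝ) ^ n * ValMap m x ∧ (m : ℝ) ^ n * ValMap m x ≤ dig x n + 1 := by
  have hm0 : (0 : ℝ) < m := by positivity
  have h1 : ∀ n, (dig x n : ℝ) = (m : ℝ) ^ n * ∑ i ∈ Finset.range n,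
      Real.ofDigitsTerm (fun k : ℕ => x ⟨k + 1, Nat.succ_pos _⟩) i := by
    intro n
    induction n with
    | zero => simp [dig]
    | succ n ih =>
      rw [Finset.sum_range_succ, mul_add, pow_succ, dig]
      push_cast
      rw [ih]
      generalize (∑ i ∈ Finset.range n,
        Real.ofDigitsTerm (fun k : ℕ => x ⟨k + 1, Nat.succ_pos _⟩) i) = S
      simp only [Real.ofDigitsTerm]
      field_simp
      try ring
  rw [ValMap_eq, Real.ofDigits_eq_sum_add_ofDigits _ n, mul_add, ← h1, ← mul_assoc,
    mul_inv_cancel₀ (by positivity), one_mul]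
  constructor
  · linarith [Real.ofDigits_nonneg (fun i : ℕ => x ⟨i + n + 1, Nat.succ_pos _⟩)]
  · linarith [Real.ofDigits_le_one (fun i : ℕ => x ⟨i + n + 1, Nat.succ_pos _⟩)]

lemma measurable_ValMap {m : ℕ} : Measurable (ValMap m) := by
  have : ValMap m = Real.ofDigits ∘ (fun (x : ℕ+ → Fin m) (k : ℕ) => x ⟨k + 1, Nat.succ_pos _⟩) := by
    funext x; exact ValMap_eq x
  rw [this]
  exact (Real.continuous_ofDigits.comp (by fun_prop)).measurable

lemma mass_piece {m : ℕ} (hm : 2 ≤ m) {Z : Type*} [MeasurableSpace Z] (M : Measure Z)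
    (g : Z → ℕ+ → Fin m) (E : Set Z) (n : ℕ) (c : ℝ≥0∞)
    (hE : ∀ ω ∈ E, M (g ⁻¹' CylN n (g ω)) ≤ c) (F : Set ℝ)
    (hF : Metric.ediam F ≤ ENNReal.ofReal (((m : ℝ) ^ n)⁻¹)) :
    M ((fun ω => ValMap m (g ω)) ⁻¹' F ∩ E) ≤ 4 * c := by
  rcases F.eq_empty_or_nonempty with rfl | ⟨p, hp⟩
  · simp
  have hm0 : (0 : ℝ) < (m : ℝ) ^ n := by positivity
  set B : Finset ℤ := Finset.Icc (⌊(m : ℝ) ^ n * p⌋ - 2) (⌊(m : ℝ) ^ n * p⌋ + 1) with hB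
  have hcard : B.card = 4 := by
    rw [hB, Int.card_Icc]
    omega
  have hsub : (fun ω => ValMap m (g ω)) ⁻¹' F ∩ E ⊆
      ⋃ b ∈ B, {ω | ω ∈ E ∧ (dig (g ω) n : ℤ) = b} := by
    rintro ω ⟨h1, h2⟩
    have h1' : ValMap m (g ω) ∈ F := h1
    have h3 : edist (ValMap m (g ω)) p ≤ ENNReal.ofReal (((m : ℝ) ^ n)⁻¹) :=
      (Metric.edist_le_ediam_of_mem h1' hp).trans hF
    rw [edist_dist, ENNReal.ofReal_le_ofReal_iff (by positivity), Real.dist_eq] at h3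
    have h4 : |(m : ℝ) ^ n * ValMap m (g ω) - (m : ℝ) ^ n * p| ≤ 1 := by
      rw [← mul_sub, abs_mul, abs_of_pos hm0]
      calc _ ≤ (m : ℝ) ^ n * ((m : ℝ) ^ n)⁻¹ := by gcongr
        _ = 1 := mul_inv_cancel₀ hm0.ne'
    obtain ⟨h5, h6⟩ := dig_val hm (g ω) n
    rw [abs_le] at h4
    refine Set.mem_biUnion (x := (dig (g ω) n : ℤ)) ?_ ⟨h2, rfl⟩
    have h7 := Int.floor_le ((m : ℝ) ^ n * p)
    have h8 := Int.lt_floor_add_one ((m : ℝ) ^ n * p)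
    show (dig (g ω) n : ℤ) ∈ B
    rw [hB, Finset.mem_Icc]
    constructor
    · have : (((⌊(m : ℝ) ^ n * p⌋ - 2 : ℤ)) : ℝ) ≤ (((dig (g ω) n : ℕ) : ℤ) : ℝ) := by
        push_cast; linarith
      exact_mod_cast this
    · have : (((dig (g ω) n : ℕ) : ℤ) : ℝ) < (((⌊(m : ℝ) ^ n * p⌋ + 2 : ℤ)) : ℝ) := by
        push_cast; linarith
      have h9 : ((dig (g ω) n : ℕ) : ℤ) < ⌊(m : ℝ) ^ n * p⌋ + 2 := by exact_mod_cast this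
      omega
  refine (measure_mono hsub).trans ((measure_biUnion_finset_le _ _).trans ?_)
  calc ∑ b ∈ B, M {ω | ω ∈ E ∧ (dig (g ω) n : ℤ) = b} ≤ ∑ b ∈ B, c := by
        refine Finset.sum_le_sum fun b _ => ?_
        rcases ({ω | ω ∈ E ∧ (dig (g ω) n : ℤ) = b} : Set Z).eq_empty_or_nonempty with h | ⟨ω0, h1, h2⟩
        · rw [h]; simp
        · refine (measure_mono ?_).trans (hE ω0 h1)
          rintro ω ⟨_, h4⟩
          refine dig_inj _ _ _ ?_
          have := h4.trans h2.symm
          exact_mod_cast this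
    _ = 4 * c := by simp [hcard]

theorem mass_dist {m : ℕ} (hm : 2 ≤ m) {Z : Type*} [MeasurableSpace Z] (M : Measure Z)
    [IsProbabilityMeasure M] (g : Z → ℕ+ → Fin m) (hg : Measurable g) (A : Set (ℕ+ → Fin m))
    (θ : NNReal)
    (h : ∀ᵐ ω ∂M, g ω ∈ A ∧ ∀ᶠ n : ℕ in atTop,
      M (g ⁻¹' CylN n (g ω)) ≤ ENNReal.ofReal ((m : ℝ) ^ (-((θ : ℝ) * n)))) :
    (θ : ℝ≥0∞) ≤ dimH (XiSet A) := by
  rcases eq_or_lt_of_le (zero_le : 0 ≤ θ) with h0 | hθ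
  · rw [← h0]; simp
  have hm1 : (1 : ℝ) < m := by exact_mod_cast (by omega : 1 < m)
  have hm0 : (0 : ℝ) < m := by linarith
  by_contra hcon
  push Not at hcon
  have hH := hausdorffMeasure_of_dimH_lt hcon
  set E : ℕ → Set Z := fun N => {ω | g ω ∈ A ∧ ∀ n : ℕ, N ≤ n →
      M (g ⁻¹' CylN n (g ω)) ≤ ENNReal.ofReal ((m : ℝ) ^ (-((θ : ℝ) * n)))} with hEdef
  have hEN : ∃ N, M (E N) ≠ 0 := by
    by_contra hno
    push Not at hno
    have h1 : M (⋃ N, E N) = 0 := measure_iUnion_null hno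
    have h2 : ∀ᵐ ω ∂M, ω ∉ ⋃ N, E N := measure_eq_zero_iff_ae_notMem.1 h1
    have h3 : ∀ᵐ ω ∂M, False := by
      filter_upwards [h, h2] with ω ⟨h4, h5⟩ h6
      obtain ⟨N, hN⟩ := eventually_atTop.1 h5
      exact h6 (Set.mem_iUnion.2 ⟨N, h4, hN⟩)
    simp at h3
    exact IsProbabilityMeasure.ne_zero M h3
  obtain ⟨N, hN⟩ := hEN
  set V : Z → ℝ := fun ω => ValMap m (g ω) with hV
  have hVm : Measurable V := measurable_ValMap.comp hg
  set C : ℝ≥0∞ := 4 * ENNReal.ofReal ((m : ℝ) ^ (θ : ℝ)) with hC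
  have hC0 : C ≠ 0 := by
    rw [hC]
    refine mul_ne_zero (by norm_num) ?_
    have : 0 < (m : ℝ) ^ (θ : ℝ) := by positivity
    simpa using this
  have hCt : C ≠ ⊤ := ENNReal.mul_ne_top (by norm_num) ENNReal.ofReal_ne_top
  have key : ∀ n : ℕ, N ≤ n → ∀ F : Set ℝ, Metric.ediam F ≤ ENNReal.ofReal (((m : ℝ) ^ n)⁻¹) →
      M (V ⁻¹' F ∩ E N) ≤ 4 * ENNReal.ofReal ((m : ℝ) ^ (-((θ : ℝ) * n))) := fun n hn F hF =>
    mass_piece hm M g (E N) n _ (fun ω hω => hω.2 n hn) F hF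
  have key2 : ∀ F : Set ℝ, Metric.ediam F ≤ ENNReal.ofReal (((m : ℝ) ^ N)⁻¹) →
      M (V ⁻¹' F ∩ E N) ≤ C * Metric.ediam F ^ (θ : ℝ) := by
    intro F hF
    have hft : Metric.ediam F ≠ ⊤ := ne_top_of_le_ne_top ENNReal.ofReal_ne_top hF
    obtain ⟨D, hD⟩ : ∃ D : NNReal, Metric.ediam F = D := ⟨_, (ENNReal.coe_toNNReal hft).symm⟩
    have hD' : Metric.ediam F = ENNReal.ofReal (D : ℝ) := by rw [hD]; simp
    rcases eq_or_lt_of_le (zero_le : 0 ≤ D) with hD0 | hDpos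
    · have hlim : Tendsto (fun n : ℕ => 4 * ENNReal.ofReal ((m : ℝ) ^ (-((θ : ℝ) * n)))) atTop
          (𝓝 (4 * ENNReal.ofReal 0)) := by
        refine ENNReal.Tendsto.const_mul (ENNReal.tendsto_ofReal ?_) (Or.inr (by norm_num))
        have h1 : ∀ n : ℕ, (m : ℝ) ^ (-((θ : ℝ) * n)) = ((m : ℝ) ^ (-(θ : ℝ))) ^ n := by
          intro n
          rw [← Real.rpow_natCast, ← Real.rpow_mul hm0.le]
          congr 1
          ring
        simp_rw [h1]
        refine tendsto_pow_atTop_nhds_zero_of_lt_one (by positivity) ?_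
        exact Real.rpow_lt_one_of_one_lt_of_neg hm1 (by simpa using hθ)
      have h2 : M (V ⁻¹' F ∩ E N) ≤ 4 * ENNReal.ofReal 0 := by
        refine ge_of_tendsto hlim (eventually_atTop.2 ⟨N, fun n hn => key n hn F ?_⟩)
        rw [hD, ← hD0]; simp
      refine h2.trans ?_
      simp
    · have hD1 : (D : ℝ) ≤ ((m : ℝ)⁻¹) ^ N := by
        rw [hD', ENNReal.ofReal_le_ofReal_iff (by positivity)] at hF
        rwa [inv_pow]
      have hinv : (m : ℝ)⁻¹ < 1 := inv_lt_one_of_one_lt₀ hm1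
      have hinv0 : 0 < (m : ℝ)⁻¹ := by positivity
      obtain ⟨n, hn1, hn2⟩ := exists_nat_pow_near_of_lt_one (x := (D : ℝ)) (y := (m : ℝ)⁻¹)
        (by exact_mod_cast hDpos) (hD1.trans (pow_le_one₀ hinv0.le hinv.le)) hinv0 hinv
      have hNn : N ≤ n := by
        have := (pow_lt_pow_iff_right_of_lt_one₀ hinv0 hinv).1 (hn1.trans_le hD1)
        omega
      refine (key n hNn F ?_).trans ?_
      · rw [hD', ← inv_pow]
        exact ENNReal.ofReal_le_ofReal hn2
      · rw [hC, mul_assoc, hD', ENNReal.ofReal_rpow_of_nonneg D.coe_nonneg θ.coe_nonneg,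
          ← ENNReal.ofReal_mul (by positivity)]
        gcongr
        calc (m : ℝ) ^ (-((θ : ℝ) * n)) = (m : ℝ) ^ (θ : ℝ) * ((m : ℝ)⁻¹ ^ (n + 1)) ^ (θ : ℝ) := by
              rw [← Real.rpow_natCast, ← Real.rpow_mul hinv0.le, Real.inv_rpow hm0.le,
                ← Real.rpow_neg hm0.le, ← Real.rpow_add hm0]
              congr 1
              push_cast
              ring
          _ ≤ _ := by gcongr
  set ν : Measure ℝ := C⁻¹ • (M.restrict (E N)).map V with hν
  have hle : ν ≤ Measure.hausdorffMeasure (θ : ℝ) := by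
    refine Measure.le_hausdorffMeasure _ _ (ENNReal.ofReal (((m : ℝ) ^ N)⁻¹)) ?_ ?_
    · rw [ENNReal.ofReal_pos]; positivity
    · intro s hs
      rw [← Metric.ediam_closure] at hs ⊢
      refine (measure_mono subset_closure).trans ?_
      rw [hν, Measure.smul_apply, Measure.map_apply hVm isClosed_closure.measurableSet,
        Measure.restrict_apply (hVm isClosed_closure.measurableSet), smul_eq_mul]
      calc _ ≤ C⁻¹ * (C * Metric.ediam (closure s) ^ (θ : ℝ)) := by
            gcongr
            exact key2 _ hs
        _ = _ := by rw [← mul_assoc, ENNReal.inv_mul_cancel hC0 hCt, one_mul]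
  set T := toMeasurable (Measure.hausdorffMeasure (θ : ℝ)) (XiSet A) with hT
  have hT0 : Measure.hausdorffMeasure (θ : ℝ) T = 0 := by rw [hT, measure_toMeasurable, hH]
  have hνT : ν T = 0 := le_antisymm ((hle T).trans hT0.le) zero_le
  rw [hν, Measure.smul_apply, Measure.map_apply hVm (measurableSet_toMeasurable _ _),
    Measure.restrict_apply (hVm (measurableSet_toMeasurable _ _)), smul_eq_mul, mul_eq_zero] at hνT
  rcases hνT with h1 | h1
  · exact (ENNReal.inv_ne_zero.2 hCt) h1
  · refine hN (le_antisymm ((measure_mono ?_).trans h1.le) zero_le)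
    intro ω hω
    exact ⟨subset_toMeasurable _ _ ⟨g ω, hω.1, rfl⟩, hω⟩

/-- composition with a linearly growing sequence -/
lemma avg_comp (a : ℕ → ℝ) (b : ℕ → ℕ) (H β : ℝ)
    (ha : Tendsto (fun N : ℕ => a N / N) atTop (𝓝 H)) (hb : Tendsto b atTop atTop)
    (hb2 : Tendsto (fun n : ℕ => (b n : ℝ) / n) atTop (𝓝 β)) :
    Tendsto (fun n : ℕ => a (b n) / n) atTop (𝓝 (H * β)) := by
  refine Tendsto.congr' ?_ ((ha.comp hb).mul hb2)
  filter_upwards [hb.eventually_gt_atTop 0] with n hn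
  have : (b n : ℝ) ≠ 0 := by exact_mod_cast hn.ne'
  simp only [Function.comp]
  field_simp

lemma div_tendsto (c : ℕ) (hc : 0 < c) :
    Tendsto (fun n : ℕ => ((n / c : ℕ) : ℝ) / n) atTop (𝓝 ((c : ℝ)⁻¹)) := by
  have h := (tendsto_nat_floor_mul_div_atTop (R := ℝ) (a := (c : ℝ)⁻¹) (by positivity)).comp
    (tendsto_natCast_atTop_atTop (R := ℝ))
  refine h.congr fun n => ?_
  simp only [Function.comp]
  congr 2
  rw [← Nat.floor_div_eq_div (K := ℝ)]
  congr 1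
  field_simp

lemma div_add_tendsto (c : ℕ) (hc : 0 < c) :
    Tendsto (fun n : ℕ => ((n / c + 1 : ℕ) : ℝ) / n) atTop (𝓝 ((c : ℝ)⁻¹)) := by
  have h := (div_tendsto c hc).add (tendsto_one_div_atTop_nhds_zero_nat (𝕜 := ℝ))
  rw [add_zero] at h
  refine h.congr fun n => ?_
  push_cast
  rw [add_div]

/-- sum over indices not divisible by `q` -/
def Snd (q : ℕ) (f : ℕ → ℝ) (N : ℕ) : ℝ :=
  ∑ i ∈ (Finset.range (N + 1)).filter (fun i => ¬ q ∣ i), f i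

lemma Snd_eq (q : ℕ) (hq : 2 ≤ q) (f : ℕ → ℝ) (N : ℕ) :
    Snd q f N = ∑ i ∈ Finset.range (N + 1), f i - ∑ j ∈ Finset.range (N / q + 1), f (q * j) := by
  have h1 : ∑ j ∈ Finset.range (N / q + 1), f (q * j) =
      ∑ i ∈ (Finset.range (N + 1)).filter (fun i => q ∣ i), f i := by
    refine Finset.sum_bij (fun j _ => q * j) ?_ ?_ ?_ ?_
    · intro j hj
      simp only [Finset.mem_filter, Finset.mem_range] at hj ⊢
      refine ⟨?_, dvd_mul_right _ _⟩
      have : j ≤ N / q := by omega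
      rw [Nat.le_div_iff_mul_le (by omega)] at this
      rw [mul_comm]; omega
    · intro a _ b _ h
      exact Nat.eq_of_mul_eq_mul_left (by omega) h
    · rintro i hi
      simp only [Finset.mem_filter, Finset.mem_range] at hi
      obtain ⟨h2, j, rfl⟩ := hi
      refine ⟨j, ?_, rfl⟩
      have : j ≤ N / q := by
        rw [Nat.le_div_iff_mul_le (by omega), mul_comm]; omega
      simp only [Finset.mem_range]; omega
    · intros; rfl
  rw [h1, Snd, ← Finset.sum_filter_add_sum_filter_not (Finset.range (N + 1)) (fun i => q ∣ i)]
  ring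

lemma tendsto_div_atTop' (c : ℕ) (hc : 0 < c) : Tendsto (fun n : ℕ => n / c) atTop atTop := by
  refine tendsto_atTop.2 fun b => ?_
  filter_upwards [eventually_ge_atTop (b * c)] with n hn
  rwa [Nat.le_div_iff_mul_le hc]

lemma Snd_tendsto (q : ℕ) (hq : 2 ≤ q) (f : ℕ → ℝ) (H : ℝ)
    (h1 : Tendsto (fun n : ℕ => (∑ i ∈ Finset.range n, f i) / n) atTop (𝓝 H))
    (h2 : Tendsto (fun n : ℕ => (∑ i ∈ Finset.range n, f (q * i)) / n) atTop (𝓝 H)) :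
    Tendsto (fun N : ℕ => Snd q f N / N) atTop (𝓝 (H * (1 - (q : ℝ)⁻¹))) := by
  have e1 := avg_comp (fun n => ∑ i ∈ Finset.range n, f i) (fun n => n / 1 + 1) H _ h1
    (tendsto_atTop_mono (fun n => Nat.le_succ _) (tendsto_div_atTop' 1 one_pos)) (div_add_tendsto 1 one_pos)
  have e2 := avg_comp (fun n => ∑ i ∈ Finset.range n, f (q * i)) (fun n => n / q + 1) H _ h2
    (tendsto_atTop_mono (fun n => Nat.le_succ _) (tendsto_div_atTop' q (by omega))) (div_add_tendsto q (by omega))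
  have e3 := e1.sub e2
  have e4 : H * (1 - (q : ℝ)⁻¹) = H * ((1 : ℕ) : ℝ)⁻¹ - H * (q : ℝ)⁻¹ := by
    push_cast; ring
  rw [e4]
  refine e3.congr fun n => ?_
  rw [Snd_eq q hq, sub_div, Nat.div_one]

lemma block_tendsto (q : ℕ) (hq : 2 ≤ q) (f : ℕ → ℝ) (H : ℝ) (k : ℕ)
    (h : Tendsto (fun N : ℕ => Snd q f N / N) atTop (𝓝 (H * (1 - (q : ℝ)⁻¹)))) :
    Tendsto (fun n : ℕ => (Snd q f (n / q ^ k) - Snd q f (n / q ^ (k + 1))) / n) atTop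
      (𝓝 (((q : ℝ) - 1) ^ 2 * (H / (q : ℝ) ^ (k + 2)))) := by
  have hq0 : (0 : ℝ) < q := by positivity
  have hp : ∀ k, 0 < q ^ k := fun k => by positivity
  have e1 := avg_comp _ (fun n => n / q ^ k) _ _ h (tendsto_div_atTop' _ (hp k)) (div_tendsto _ (hp k))
  have e2 := avg_comp _ (fun n => n / q ^ (k + 1)) _ _ h (tendsto_div_atTop' _ (hp _))
    (div_tendsto _ (hp _))
  have e3 := e1.sub e2
  have e4 : ((q : ℝ) - 1) ^ 2 * (H / (q : ℝ) ^ (k + 2)) =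
    H * (1 - (q : ℝ)⁻¹) * ((q ^ k : ℕ) : ℝ)⁻¹ - H * (1 - (q : ℝ)⁻¹) * ((q ^ (k + 1) : ℕ) : ℝ)⁻¹ := by
    push_cast
    field_simp
    ring
  rw [e4]
  refine e3.congr fun n => ?_
  rw [sub_div]

/-- length of the part of `J_i` below `n` -/
def kk (q n i : ℕ) : ℕ := Nat.log q (n / i) + 1

lemma lt_kk (q : ℕ) (hq : 2 ≤ q) (n i l : ℕ) (hi : 0 < i) (hin : i ≤ n) :
    l < kk q n i ↔ q ^ l * i ≤ n := by
  unfold kk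
  have h : n / i ≠ 0 := (Nat.div_pos hin hi).ne'
  rw [Nat.lt_succ_iff, Nat.le_log_iff_pow_le (by omega) h, Nat.le_div_iff_mul_le hi]

lemma kk_eq_iff (q : ℕ) (hq : 2 ≤ q) (n i k : ℕ) (hi : 0 < i) (hin : i ≤ n) :
    kk q n i = k + 1 ↔ n / q ^ (k + 1) < i ∧ i ≤ n / q ^ k := by
  have h1 := lt_kk q hq n i k hi hin
  have h2 := lt_kk q hq n i (k + 1) hi hin
  have hp : ∀ k, 0 < q ^ k := fun k => by positivity
  rw [Nat.div_lt_iff_lt_mul (hp _), Nat.le_div_iff_mul_le (hp _), mul_comm i, mul_comm i]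
  constructor
  · intro h
    exact ⟨by rw [← not_le, ← h2]; omega, h1.1 (by omega)⟩
  · rintro ⟨h3, h4⟩
    have h5 := h1.2 h4
    rw [← not_le, ← h2] at h3
    omega

lemma block_eq (q : ℕ) (hq : 2 ≤ q) (f : ℕ → ℝ) (n k : ℕ) :
    Snd q f (n / q ^ k) - Snd q f (n / q ^ (k + 1)) =
      ∑ i ∈ ((Finset.range (n + 1)).filter (fun i => ¬ q ∣ i)).filter (fun i => kk q n i = k + 1),
        f i := by
  have hle : n / q ^ (k + 1) ≤ n / q ^ k := Nat.div_le_div_left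
    (Nat.pow_le_pow_right (by omega) (by omega)) (by positivity)
  have hle2 : n / q ^ k ≤ n := Nat.div_le_self _ _
  unfold Snd
  rw [sub_eq_iff_eq_add']
  rw [← Finset.sum_union]
  · refine Finset.sum_congr ?_ fun _ _ => rfl
    ext i
    simp only [Finset.mem_union, Finset.mem_filter, Finset.mem_range]
    rcases Nat.eq_zero_or_pos i with rfl | hi
    · simp
    constructor
    · rintro ⟨h1, h2⟩
      by_cases h3 : i < n / q ^ (k + 1) + 1
      · exact Or.inl ⟨h3, h2⟩
      · refine Or.inr ⟨⟨by omega, h2⟩, ?_⟩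
        rw [kk_eq_iff q hq n i k hi (by omega)]
        omega
    · rintro (⟨h1, h2⟩ | ⟨⟨h1, h2⟩, h3⟩)
      · exact ⟨by omega, h2⟩
      · rw [kk_eq_iff q hq n i k hi (by omega)] at h3
        exact ⟨by omega, h2⟩
  · rw [Finset.disjoint_left]
    intro i h1 h2
    simp only [Finset.mem_filter, Finset.mem_range] at h1 h2
    have hi : 0 < i := Nat.pos_of_ne_zero (by rintro rfl; exact h1.2 (dvd_zero _))
    have h3 := h2.2
    rw [kk_eq_iff q hq n i k hi (by omega)] at h3
    omega

lemma blocks_le (q : ℕ) (hq : 2 ≤ q) (Y : ℕ → ℕ → ℝ) (hY : ∀ k i, 0 ≤ Y k i) (n K : ℕ) :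
    ∑ k ∈ Finset.range K, (Snd q (Y (k + 1)) (n / q ^ k) - Snd q (Y (k + 1)) (n / q ^ (k + 1))) ≤
      ∑ i ∈ (Finset.range (n + 1)).filter (fun i => ¬ q ∣ i), Y (kk q n i) i := by
  have hrw : ∀ k ∈ Finset.range K,
      Snd q (Y (k + 1)) (n / q ^ k) - Snd q (Y (k + 1)) (n / q ^ (k + 1)) =
      ∑ i ∈ (Finset.range (n + 1)).filter (fun i => ¬ q ∣ i),
        (if kk q n i = k + 1 then Y (k + 1) i else 0) := fun k _ => by
    rw [block_eq q hq, Finset.sum_filter _ (fun i => Y _ i)]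
  rw [Finset.sum_congr rfl hrw, Finset.sum_comm]
  refine Finset.sum_le_sum fun i _ => ?_
  calc ∑ k ∈ Finset.range K, (if kk q n i = k + 1 then Y (k + 1) i else 0)
      ≤ ∑ k ∈ Finset.range K, (if k = kk q n i - 1 then Y (kk q n i) i else 0) := by
        refine Finset.sum_le_sum fun k _ => ?_
        split_ifs with h1 h2 h2
        · rw [h1]
        · omega
        · exact hY _ _
        · exact le_rfl
    _ ≤ _ := by
        rw [Finset.sum_ite_eq']
        split_ifs
        · exact le_rfl
        · exact hY _ _

/-- exponent of `q` in `r` -/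
def ordq (q r : ℕ) : ℕ := multiplicity q r

/-- part of `r` prime to `q` -/
def coreq (q r : ℕ) : ℕ := r / q ^ ordq q r

lemma ordq_mul (q : ℕ) (hq : 2 ≤ q) (l i : ℕ) (hi : ¬ q ∣ i) : ordq q (q ^ l * i) = l := by
  refine multiplicity_eq_of_dvd_of_not_dvd (dvd_mul_right _ _) ?_
  rw [pow_succ]
  intro h
  exact hi (Nat.dvd_of_mul_dvd_mul_left (by positivity) h)

lemma coreq_mul (q : ℕ) (hq : 2 ≤ q) (l i : ℕ) (hi : ¬ q ∣ i) : coreq q (q ^ l * i) = i := by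
  rw [coreq, ordq_mul q hq l i hi, Nat.mul_div_cancel_left _ (by positivity)]

/-- glue independent sequences along the progressions -/
def glue {m : ℕ} (q : ℕ) (ω : ℕ → ℕ+ → Fin m) (r : ℕ+) : Fin m :=
  ω (coreq q r) ⟨ordq q r + 1, Nat.succ_pos _⟩

lemma glue_mul {m : ℕ} (q : ℕ+) (hq : 2 ≤ (q : ℕ)) (ω : ℕ → ℕ+ → Fin m) (l : ℕ) (i : ℕ+)
    (hi : ¬ (q : ℕ) ∣ (i : ℕ)) :
    glue q ω (q ^ l * i) = ω i ⟨l + 1, Nat.succ_pos _⟩ := by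
  unfold glue
  have h : ((q ^ l * i : ℕ+) : ℕ) = (q : ℕ) ^ l * i := by simp
  simp only [h, ordq_mul q hq l i hi, coreq_mul q hq l i hi]

lemma measurable_glue {m : ℕ} (q : ℕ) : Measurable (glue (m := m) q) := by
  unfold glue
  fun_prop

lemma glue_restr {m : ℕ} (q : ℕ+) (hq : 2 ≤ (q : ℕ)) (ω : ℕ → ℕ+ → Fin m) (i : ℕ+)
    (hi : ¬ (q : ℕ) ∣ (i : ℕ)) : RestrJ q (glue q ω) i = ω i := by
  funext k
  unfold RestrJ
  rw [glue_mul q hq ω _ i hi]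
  congr 1
  exact PNat.eq (Nat.sub_add_cancel k.pos)

lemma glue_cyl {m : ℕ} (q : ℕ+) (hq : 2 ≤ (q : ℕ)) (ω : ℕ → ℕ+ → Fin m) (n : ℕ) :
    glue q ⁻¹' CylN n (glue q ω) ⊆
      Set.pi ((Finset.range (n + 1)).filter (fun i => ¬ (q : ℕ) ∣ i) : Finset ℕ)
        (fun i => Cyl (pre (ω i) (kk q n i))) := by
  intro ω' h i hi
  simp only [Finset.coe_filter, Finset.mem_range] at hi
  obtain ⟨h1, h2⟩ := hi
  have hi0 : 0 < i := Nat.pos_of_ne_zero (by rintro rfl; exact h2 (dvd_zero _))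
  rw [mem_Cyl_pre]
  unfold pre
  congr 1
  funext j
  have h3 := (lt_kk q hq n i j hi0 (by omega)).1 j.2
  obtain ⟨i', rfl⟩ : ∃ i' : ℕ+, (i' : ℕ) = i := ⟨⟨i, hi0⟩, rfl⟩
  have h4 := h (q ^ (j : ℕ) * i') (by simpa using h3)
  rwa [glue_mul q hq _ _ _ h2, glue_mul q hq _ _ _ h2] at h4

lemma glue_meas {m : ℕ} (q : ℕ+) (hq : 2 ≤ (q : ℕ)) (μ : Measure (ℕ+ → Fin m))
    [IsProbabilityMeasure μ] (ω : ℕ → ℕ+ → Fin m) (n : ℕ) :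
    Measure.infinitePi (fun _ : ℕ => μ) (glue q ⁻¹' CylN n (glue q ω)) ≤
      ∏ i ∈ (Finset.range (n + 1)).filter (fun i => ¬ (q : ℕ) ∣ i),
        μ (Cyl (pre (ω i) (kk q n i))) := by
  refine (measure_mono (glue_cyl q hq ω n)).trans (le_of_eq ?_)
  exact Measure.infinitePi_pi _ (fun i _ => measurableSet_Cyl _)

lemma Yinf_nonneg {m : ℕ} (hm : 2 ≤ m) (μ : Measure (ℕ+ → Fin m)) [IsProbabilityMeasure μ]
    (k : ℕ) (x : ℕ+ → Fin m) : 0 ≤ Yinf μ k x := by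
  unfold Yinf
  rw [neg_nonneg]
  exact Real.logb_nonpos (by exact_mod_cast (by omega : 1 < m)) ENNReal.toReal_nonneg
    (ENNReal.toReal_le_of_le_ofReal zero_le_one (by simpa using prob_le_one))

lemma prod_le_of_Yinf {m : ℕ} (hm : 2 ≤ m) (μ : Measure (ℕ+ → Fin m)) [IsProbabilityMeasure μ]
    (s : Finset ℕ) (ω : ℕ → ℕ+ → Fin m) (κ : ℕ → ℕ) (c : ℝ)
    (h : c ≤ ∑ i ∈ s, Yinf μ (κ i) (ω i)) :
    ∏ i ∈ s, μ (Cyl (pre (ω i) (κ i))) ≤ ENNReal.ofReal ((m : ℝ) ^ (-c)) := by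
  have hm1 : (1 : ℝ) < m := by exact_mod_cast (by omega : 1 < m)
  have hm0 : (0 : ℝ) < m := by linarith
  by_cases hz : ∃ i ∈ s, μ (Cyl (pre (ω i) (κ i))) = 0
  · obtain ⟨i, hi, h0⟩ := hz
    rw [Finset.prod_eq_zero hi h0]
    exact zero_le
  push Not at hz
  have h1 : ∀ i ∈ s, μ (Cyl (pre (ω i) (κ i))) =
      ENNReal.ofReal ((m : ℝ) ^ (-Yinf μ (κ i) (ω i))) := by
    intro i hi
    have hp : 0 < (μ (Cyl (pre (ω i) (κ i)))).toReal :=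
      ENNReal.toReal_pos (hz i hi) (measure_ne_top _ _)
    unfold Yinf
    rw [neg_neg, Real.rpow_logb hm0 hm1.ne' hp, ENNReal.ofReal_toReal (measure_ne_top _ _)]
  rw [Finset.prod_congr rfl h1, ← ENNReal.ofReal_prod_of_nonneg (fun i _ => by positivity),
    ← Real.rpow_sum_of_pos hm0, Finset.sum_neg_distrib]
  refine ENNReal.ofReal_le_ofReal (Real.rpow_le_rpow_of_exponent_le hm1.le (by linarith))

lemma slln_sub {m : ℕ} (μ : Measure (ℕ+ → Fin m)) [IsProbabilityMeasure μ] (k : ℕ)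
    (φ : ℕ → ℕ) (hφ : Function.Injective φ) :
    ∀ᵐ ω ∂(Measure.infinitePi (fun _ : ℕ => μ)),
      Tendsto (fun n : ℕ => (∑ i ∈ Finset.range n, Yinf μ k (ω (φ i))) / n) atTop
        (𝓝 (Hent m μ k)) := by
  have hYm : Measurable (Yinf μ k) :=
    measurable_comp_pre k (fun u => - Real.logb m (μ (Cyl u)).toReal)
  have hYi : Integrable (Yinf μ k) μ :=
    integrable_comp_pre μ k (fun u => - Real.logb m (μ (Cyl u)).toReal)
  have hev : ∀ i : ℕ, MeasurePreserving (fun ω : ℕ → ℕ+ → Fin m => ω i)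
      (Measure.infinitePi (fun _ : ℕ => μ)) μ := fun i =>
    measurePreserving_eval_infinitePi (fun _ : ℕ => μ) i
  have h := ProbabilityTheory.strong_law_ae_real (μ := Measure.infinitePi (fun _ : ℕ => μ))
    (fun i ω => Yinf μ k (ω (φ i))) ((hev _).integrable_comp_of_integrable hYi) ?_ ?_
  · have e : ∫ ω, Yinf μ k (ω (φ 0)) ∂(Measure.infinitePi (fun _ : ℕ => μ)) = Hent m μ k := by
      rw [Hent_eq_integral, ← (hev (φ 0)).map_eq, integral_map (hev _).measurable.aemeasurable
        (by rw [(hev (φ 0)).map_eq]; exact hYm.aestronglyMeasurable), (hev (φ 0)).map_eq]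
    rwa [e] at h
  · intro i j hij
    exact (ProbabilityTheory.iIndepFun_infinitePi (P := fun _ : ℕ => μ)
      (X := fun _ => Yinf μ k) (fun _ => hYm)).indepFun (hφ.ne hij)
  · intro i
    refine ⟨(hYm.comp (hev _).measurable).aemeasurable, (hYm.comp (hev _).measurable).aemeasurable, ?_⟩
    show Measure.map (Yinf μ k ∘ _) _ = Measure.map (Yinf μ k ∘ _) _
    rw [← Measure.map_map hYm (hev _).measurable, ← Measure.map_map hYm (hev _).measurable,
      (hev _).map_eq, (hev _).map_eq]

theorem dimH_lower {m : ℕ} (hm : 2 ≤ m) (q : ℕ+) (hq : 2 ≤ (q : ℕ)) (Ω : Set (ℕ+ → Fin m))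
    (hcl : IsClosed Ω) (μ : Measure (ℕ+ → Fin m)) [IsProbabilityMeasure μ] (hμ : μ Ω = 1) :
    ENNReal.ofReal (sOm m q μ) ≤ dimH (XiSet (XOm q Ω)) := by
  refine le_of_forall_lt fun d' hd' => ?_
  obtain ⟨θ, hθ1, hθ2⟩ := ENNReal.lt_iff_exists_nnreal_btwn.1 hd'
  refine hθ1.trans_le ?_
  have hθ : (θ : ℝ) < sOm m q μ := by
    rw [← ENNReal.ofReal_coe_nnreal, ENNReal.ofReal_lt_ofReal_iff'] at hθ2
    exact hθ2.1
  have hsum : Summable (fun k : ℕ => Hent m μ (k + 1) / (q : ℝ) ^ (k + 2)) := by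
    by_contra hns
    rw [sOm, tsum_eq_zero_of_not_summable hns, mul_zero] at hθ
    exact absurd hθ (not_lt.2 θ.coe_nonneg)
  have hpart : ∃ K : ℕ, (θ : ℝ) <
      ∑ k ∈ Finset.range K, ((q : ℝ) - 1) ^ 2 * (Hent m μ (k + 1) / (q : ℝ) ^ (k + 2)) := by
    have h1 := (hsum.hasSum.mul_left (((q : ℝ) - 1) ^ 2)).tendsto_sum_nat
    exact (h1.eventually (lt_mem_nhds hθ)).exists
  obtain ⟨K, hK⟩ := hpart
  refine mass_dist hm (Measure.infinitePi (fun _ : ℕ => μ)) (glue q) (measurable_glue _) _ θ ?_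
  have hsl : ∀ᵐ ω ∂(Measure.infinitePi (fun _ : ℕ => μ)), ∀ k : ℕ,
      Tendsto (fun n : ℕ => (∑ i ∈ Finset.range n, Yinf μ k (ω i)) / n) atTop
        (𝓝 (Hent m μ k)) := ae_all_iff.2 fun k => slln_sub μ k id Function.injective_id
  have hsl2 : ∀ᵐ ω ∂(Measure.infinitePi (fun _ : ℕ => μ)), ∀ k : ℕ,
      Tendsto (fun n : ℕ => (∑ i ∈ Finset.range n, Yinf μ k (ω (q * i))) / n) atTop
        (𝓝 (Hent m μ k)) := ae_all_iff.2 fun k => slln_sub μ k (fun i => q * i)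
          (fun a b h => Nat.eq_of_mul_eq_mul_left q.pos h)
  have hΩ : ∀ᵐ ω ∂(Measure.infinitePi (fun _ : ℕ => μ)), ∀ i : ℕ, ω i ∈ Ω := by
    refine ae_all_iff.2 fun i => ?_
    have h1 : ∀ᵐ x ∂μ, x ∈ Ω := by
      rw [← prob_compl_eq_zero_iff hcl.measurableSet] at hμ
      exact hμ
    exact (measurePreserving_eval_infinitePi (fun _ : ℕ => μ) i).quasiMeasurePreserving.ae h1
  filter_upwards [hsl, hsl2, hΩ] with ω h1 h2 h3
  refine ⟨?_, ?_⟩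
  · intro i hi
    rw [glue_restr q hq ω i (fun h => hi (PNat.dvd_iff.2 h))]
    exact h3 _
  · have h4 := tendsto_finsetSum (Finset.range K) fun k _ =>
      block_tendsto q hq (fun i => Yinf μ (k + 1) (ω i)) _ k
        (Snd_tendsto q hq _ _ (h1 (k + 1)) (h2 (k + 1)))
    filter_upwards [h4.eventually (lt_mem_nhds hK), eventually_gt_atTop 0] with n hn hn0
    refine (glue_meas q hq μ ω n).trans (prod_le_of_Yinf hm μ _ ω _ _ ?_)
    refine le_trans ?_ (blocks_le q hq (fun k i => Yinf μ k (ω i))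
      (fun k i => Yinf_nonneg hm μ k (ω i)) n K)
    rw [← Finset.sum_div, lt_div_iff₀ (by exact_mod_cast hn0)] at hn
    exact hn.le

/-- **Proposition 2.4 (variational principle).** `dim_H(Ξ_Ω) = sup_μ s(Ω,μ)` over Borel
probability measures supported on `Ω`, and the supremum is attained. -/
theorem stmt12 (m : ℕ) (hm : 2 ≤ m) (q : ℕ+) (hq : 2 ≤ (q : ℕ))
    (Ω : Set (ℕ+ → Fin m)) (hne : Ω.Nonempty) (hcl : IsClosed Ω) :
    dimH (XiSet (XOm q Ω)) =
      sSup {d : ℝ≥0∞ | ∃ μ : Measure (ℕ+ → Fin m),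
        IsProbabilityMeasure μ ∧ μ Ω = 1 ∧ d = ENNReal.ofReal (sOm m q μ)} ∧
    ∃ μ : Measure (ℕ+ → Fin m), IsProbabilityMeasure μ ∧ μ Ω = 1 ∧
      dimH (XiSet (XOm q Ω)) = ENNReal.ofReal (sOm m q μ) := by
  obtain ⟨t, ht⟩ := exists_TSol hm q hq Ω
  obtain ⟨μ, hμp, hμ, hc⟩ := exists_CylVals q Ω hne hcl t ht
  have heq : dimH (XiSet (XOm q Ω)) = ENNReal.ofReal (sOm m q μ) := by
    refine le_antisymm ?_ (dimH_lower hm q hq Ω hcl μ hμ)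
    rw [sOm_opt hm q hq Ω hcl t ht μ hμ hc]
    exact dimH_upper hm q hq Ω hne t ht
  refine ⟨le_antisymm (le_sSup ⟨μ, hμp, hμ, heq⟩) (sSup_le ?_), μ, hμp, hμ, heq⟩
  rintro d ⟨ν, hνp, hν, rfl⟩
  exact dimH_lower hm q hq Ω hcl ν hν
end
end

section
/- Let m ≥ 2, let q ≥ 2 be an integer, let A be a primitive m×m 0-1 matrix, and let Σ_A = {(x_k)_{k≥1} ∈ Σ_m : A(x_k, x_{k+1}) = 1 for all k ≥ 1} be the associated (additive) shift of finite type. Let (t_i)_{i=0}^{m-1} be the unique vector with t_i > 1 and t_i^q = Σ_j A(i,j) t_j. Then the unique Borel probability measure on Σ_A maximizing ν ↦ s(Σ_A, ν) is the Markov measure with initial probability vector p = (Σ_{i=0}^{m-1} t_i)^{-1} (t_0,…,t_{m-1}) and transition probabilities p_{ij} = t_j / t_i^q whenever A(i,j) = 1 (and p_{ij} = 0 otherwise); that is, the measure μ with μ[x₁…x_n] = p_{x₁} p_{x₁x₂} ⋯ p_{x_{n-1}x_n}. -/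
open scoped Classical ENNReal
open Filter MeasureTheory Topology

noncomputable section

/-- restriction to the first `k` coordinates -/
def prK (m k : ℕ) (x : ℕ+ → Fin m) : Fin k → Fin m :=
  fun j => x ⟨(j : ℕ) + 1, Nat.succ_pos _⟩

lemma measurable_prK (m k : ℕ) : Measurable (prK m k) :=
  measurable_pi_lambda _ fun _ => measurable_pi_apply _

lemma Cyl_eq {m k : ℕ} (u : Fin k → Fin m) : Cyl (List.ofFn u) = prK m k ⁻¹' {u} := by
  ext x
  simp only [Cyl, Begins, Set.mem_ofPred_eq, Set.mem_preimage, Set.mem_singleton_iff, prK,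
    funext_iff]
  constructor
  · intro h j
    have := h ⟨j, by simp⟩
    simpa using this
  · intro h j
    have := h ⟨j, by simpa using j.2⟩
    simpa using this

lemma sum_cyl {m k : ℕ} (ν : Measure (ℕ+ → Fin m)) [IsProbabilityMeasure ν]
    (g : (Fin k → Fin m) → ℝ) :
    ∑ u, (ν (Cyl (List.ofFn u))).toReal * g u = ∫ x, g (prK m k x) ∂ν := by
  have : IsProbabilityMeasure (ν.map (prK m k)) :=
    Measure.isProbabilityMeasure_map (measurable_prK m k).aemeasurable
  rw [← integral_map (φ := prK m k) (measurable_prK m k).aemeasurable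
    (measurable_of_finite g).aestronglyMeasurable, integral_fintype .of_finite]
  refine Finset.sum_congr rfl fun u _ => ?_
  rw [Cyl_eq, Measure.real, Measure.map_apply (measurable_prK m k) (measurableSet_singleton u)]
  rfl

lemma sum_cyl_one {m : ℕ} (k : ℕ) (ν : Measure (ℕ+ → Fin m)) [IsProbabilityMeasure ν] :
    ∑ u : Fin k → Fin m, (ν (Cyl (List.ofFn u))).toReal = 1 := by
  have := sum_cyl (k := k) ν (fun _ => 1)
  simpa using this

lemma gibbs_term {p r : ℝ} (hp : 0 ≤ p) (hr : 0 ≤ r) (h : r = 0 → p = 0) :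
    0 ≤ p * Real.log p - p * Real.log r + r - p ∧
    (p * Real.log p - p * Real.log r + r - p = 0 → p = r) := by
  rcases eq_or_lt_of_le hr with hr0 | hr0
  · have := h hr0.symm
    subst this
    simp [← hr0]
  · have key : p * Real.log p - p * Real.log r + r - p = r * InformationTheory.klFun (p / r) := by
      rw [InformationTheory.klFun_apply]
      rcases eq_or_lt_of_le hp with hp0 | hp0
      · simp [← hp0]
      · rw [Real.log_div hp0.ne' hr0.ne']
        field_simp
    rw [key]
    refine ⟨mul_nonneg hr (InformationTheory.klFun_nonneg (by positivity)), fun h0 => ?_⟩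
    have h1 := (mul_eq_zero.1 h0).resolve_left hr0.ne'
    rw [InformationTheory.klFun_eq_zero_iff (by positivity), div_eq_one_iff_eq hr0.ne'] at h1
    exact h1

lemma gibbs {ι : Type*} [Fintype ι] (p r : ι → ℝ) (hp : ∀ i, 0 ≤ p i) (hr : ∀ i, 0 ≤ r i)
    (h : ∀ i, r i = 0 → p i = 0) (hs : ∑ i, p i = ∑ i, r i) :
    -∑ i, p i * Real.log (p i) ≤ -∑ i, p i * Real.log (r i) ∧
    (-∑ i, p i * Real.log (p i) = -∑ i, p i * Real.log (r i) → ∀ i, p i = r i) := by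
  have key : ∑ i, (p i * Real.log (p i) - p i * Real.log (r i) + r i - p i) =
      ∑ i, p i * Real.log (p i) - ∑ i, p i * Real.log (r i) := by
    simp only [Finset.sum_sub_distrib, Finset.sum_add_distrib, hs]
    ring
  have nn : ∀ i ∈ Finset.univ, 0 ≤ p i * Real.log (p i) - p i * Real.log (r i) + r i - p i :=
    fun i _ => (gibbs_term (hp i) (hr i) (h i)).1
  have := Finset.sum_nonneg nn
  refine ⟨by linarith, fun he i => ?_⟩
  have h0 := (Finset.sum_eq_zero_iff_of_nonneg nn).1 (by linarith) i (Finset.mem_univ _)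
  exact (gibbs_term (hp i) (hr i) (h i)).2 h0

lemma ext_cyl {m : ℕ} (μ ν : Measure (ℕ+ → Fin m)) [IsProbabilityMeasure μ]
    [IsProbabilityMeasure ν]
    (h : ∀ (n : ℕ) (u : Fin (n + 1) → Fin m), ν (Cyl (List.ofFn u)) = μ (Cyl (List.ofFn u))) :
    ν = μ := by
  have hmap : ∀ n, ν.map (prK m (n + 1)) = μ.map (prK m (n + 1)) := by
    intro n
    refine Measure.ext_of_singleton fun u => ?_
    rw [Measure.map_apply (measurable_prK m _) (measurableSet_singleton u),
      Measure.map_apply (measurable_prK m _) (measurableSet_singleton u), ← Cyl_eq, h]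
  refine IsProjectiveLimit.unique (P := fun I => μ.map I.restrict) (fun I => ?_) (fun I => rfl)
  obtain ⟨N, hN⟩ : ∃ N : ℕ, ∀ i ∈ I, (i : ℕ) - 1 < N + 1 :=
    ⟨I.sup (fun i => (i : ℕ)), fun i hi => by
      have := Finset.le_sup (f := fun i : ℕ+ => (i : ℕ)) hi
      omega⟩
  let g : (Fin (N + 1) → Fin m) → (∀ i : I, Fin m) := fun u i => u ⟨(i : ℕ+) - 1, hN _ i.2⟩
  have hg : (I.restrict : (ℕ+ → Fin m) → _) = g ∘ prK m (N + 1) := by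
    funext x i
    simp only [Finset.restrict, Function.comp, g, prK]
    congr 1
    apply PNat.eq
    have := (i : ℕ+).pos
    simp only [PNat.mk_coe]
    omega
  change ν.map I.restrict = μ.map I.restrict
  rw [hg, ← Measure.map_map (measurable_of_finite g) (measurable_prK m _),
    ← Measure.map_map (measurable_of_finite g) (measurable_prK m _), hmap]

/-- chain driven by independent random maps -/
def chainX {m : ℕ} (i0 : Fin m) (F : ℕ × Fin m → Fin m) : ℕ → Fin m
  | 0 => F (0, i0)
  | n + 1 => F (n + 1, chainX i0 F n)

lemma measurable_chainX {m : ℕ} (i0 : Fin m) (n : ℕ) :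
    Measurable (fun F : ℕ × Fin m → Fin m => chainX i0 F n) := by
  induction n with
  | zero => exact measurable_pi_apply _
  | succ n ih =>
    have : (fun F : ℕ × Fin m → Fin m => chainX i0 F (n + 1)) =
        (fun z : Fin m × (Fin m → Fin m) => z.2 z.1) ∘
          (fun F => (chainX i0 F n, fun i => F (n + 1, i))) := rfl
    rw [this]
    exact (measurable_of_finite _).comp
      (ih.prodMk (measurable_pi_lambda _ fun i => measurable_pi_apply _))

lemma exists_markov {m : ℕ} (i0 : Fin m) (p : Fin m → ℝ) (P : Fin m → Fin m → ℝ)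
    (hp : ∀ i, 0 ≤ p i) (hP : ∀ i j, 0 ≤ P i j) (hp1 : ∑ i, p i = 1) (hP1 : ∀ i, ∑ j, P i j = 1) :
    ∃ μ : Measure (ℕ+ → Fin m), IsProbabilityMeasure μ ∧
      ∀ (n : ℕ) (u : Fin (n + 1) → Fin m), μ (Cyl (List.ofFn u)) =
        ENNReal.ofReal (p (u 0) * ∏ i : Fin n, P (u i.castSucc) (u i.succ)) := by
  have mk : ∀ w : Fin m → ℝ, (∀ i, 0 ≤ w i) → ∑ i, w i = 1 →
      ∃ ρ : Measure (Fin m), IsProbabilityMeasure ρ ∧ ∀ i, ρ {i} = ENNReal.ofReal (w i) := by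
    intro w hw hw1
    refine ⟨(PMF.ofFintype (fun i => ENNReal.ofReal (w i)) ?_).toMeasure, inferInstance, ?_⟩
    · rw [← ENNReal.ofReal_sum_of_nonneg (fun i _ => hw i), hw1, ENNReal.ofReal_one]
    · intro i
      rw [PMF.toMeasure_apply_singleton _ _ (measurableSet_singleton i)]
      rfl
  obtain ⟨ρ0, hρ0, hρ0'⟩ := mk p hp hp1
  choose R hR hR' using fun i => mk (P i) (hP i) (hP1 i)
  let κ : ℕ × Fin m → Measure (Fin m) := fun z => if z.1 = 0 then ρ0 else R z.2
  have hκ : ∀ z, IsProbabilityMeasure (κ z) := by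
    intro z
    simp only [κ]
    split_ifs
    · exact hρ0
    · exact hR _
  let Φ : (ℕ × Fin m → Fin m) → (ℕ+ → Fin m) := fun F k => chainX i0 F ((k : ℕ) - 1)
  have hΦ : Measurable Φ := measurable_pi_lambda _ fun k => measurable_chainX i0 _
  refine ⟨(Measure.infinitePi κ).map Φ, Measure.isProbabilityMeasure_map hΦ.aemeasurable, ?_⟩
  intro n u
  let idx : Fin (n + 1) → ℕ × Fin m := Fin.cases (0, i0) (fun i => ((i : ℕ) + 1, u i.castSucc))
  have idx1 : ∀ j, (idx j).1 = j := by
    intro j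
    refine Fin.cases ?_ (fun i => ?_) j <;> simp [idx]
  have idxinj : Function.Injective idx := fun a b hab => by
    apply Fin.ext
    rw [← idx1 a, ← idx1 b, hab]
  let tt : ℕ × Fin m → Set (Fin m) := fun z => {if h : z.1 < n + 1 then u ⟨z.1, h⟩ else i0}
  have htt : ∀ j, tt (idx j) = {u j} := by
    intro j
    have h1 := idx1 j
    have : (idx j).1 < n + 1 := by rw [h1]; exact j.2
    simp only [tt, this, dif_pos]
    congr 2
    exact Fin.ext h1
  have hset : Φ ⁻¹' (Cyl (List.ofFn u)) =
      Set.pi ((Finset.univ.image idx : Finset (ℕ × Fin m)) : Set (ℕ × Fin m)) tt := by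
    ext F
    rw [Cyl_eq]
    simp only [Set.mem_preimage, Set.mem_singleton_iff, Set.mem_pi, Finset.mem_coe,
      Finset.mem_image, Finset.mem_univ, true_and, forall_exists_index, forall_apply_eq_imp_iff,
      htt]
    have e1 : prK m (n + 1) (Φ F) = u ↔ ∀ j : Fin (n + 1), chainX i0 F j = u j := by
      simp [funext_iff, prK, Φ]
    rw [e1]
    constructor
    · intro h j
      induction j using Fin.cases with
      | zero =>
        have h1 : chainX i0 F 0 = u 0 := h 0
        exact h1
      | succ i =>
        have h1 := h i.succ
        have h2 := h i.castSucc
        simp only [Fin.val_succ, chainX, Fin.val_castSucc] at h1 h2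
        rw [h2] at h1
        simpa [idx] using h1
    · intro h j
      induction j using Fin.induction with
      | zero => simpa [chainX, idx] using h 0
      | succ i ih =>
        have h1 := h i.succ
        simp only [Fin.val_castSucc] at ih
        simp only [Fin.val_succ, chainX, ih]
        simpa [idx] using h1
  have hm : MeasurableSet (Cyl (List.ofFn u)) := by
    rw [Cyl_eq]
    exact measurable_prK m _ (measurableSet_singleton u)
  rw [Measure.map_apply hΦ hm, hset, Measure.infinitePi_pi κ (fun i _ => Set.toFinite _ |>.measurableSet),
    Finset.prod_image (fun a _ b _ hab => idxinj hab)]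
  simp only [htt]
  rw [Fin.prod_univ_succ, ENNReal.ofReal_mul (hp _),
    ENNReal.ofReal_prod_of_nonneg (fun i _ => hP _ _)]
  simp [κ, idx, hρ0', hR']

lemma hasSum_tele (q : ℝ) (hq : 2 ≤ q) (L C : ℝ) (b : ℕ → ℝ) (hb0 : b 0 = 0)
    (hb : ∀ n, |b n| ≤ n * C) :
    HasSum (fun n : ℕ => (L - b (n + 1) + q * b n) / q ^ (n + 2)) (L / (q * (q - 1))) := by
  have hq0 : 0 < q := by linarith
  have hr : ‖q⁻¹‖ < 1 := by
    rw [Real.norm_of_nonneg (by positivity)]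
    exact inv_lt_one_of_one_lt₀ (by linarith)
  have hg : Summable (fun n : ℕ => b n / q ^ (n + 1)) := by
    have h1 := (summable_pow_mul_geometric_of_norm_lt_one 1 hr).mul_right (C / q)
    refine Summable.of_norm_bounded h1 fun n => ?_
    rw [norm_div, Real.norm_eq_abs, Real.norm_of_nonneg (by positivity : 0 ≤ q ^ (n + 1))]
    calc |b n| / q ^ (n + 1) ≤ (n * C) / q ^ (n + 1) := by
          gcongr
          exact hb n
      _ = _ := by rw [inv_pow, pow_succ]; field_simp
  have h2 := (hasSum_nat_add_iff' 1).2 hg.hasSum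
  have h3 := hg.hasSum.sub h2
  simp only [Finset.sum_range_one, hb0, zero_div, sub_zero, sub_self] at h3
  have h4 := (hasSum_geometric_of_norm_lt_one hr).mul_left (L / q ^ 2)
  have h5 : L / q ^ 2 * (1 - q⁻¹)⁻¹ + 0 = L / (q * (q - 1)) := by
    have h6 : q - 1 ≠ 0 := by
      have : 0 < q - 1 := by linarith
      exact this.ne'
    rw [show 1 - q⁻¹ = (q - 1) / q by field_simp, add_zero]
    field_simp
  rw [← h5]
  have h7 := h4.add h3
  refine (funext fun n => ?_ : (fun n : ℕ => (L - b (n + 1) + q * b n) / q ^ (n + 2)) = _) ▸ h7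
  rw [inv_pow]
  simp only [pow_succ]
  field_simp
  ring

/-- **Corollary 2.6.** For a primitive shift of finite type `Σ_A`, the unique maximizer of
`ν ↦ s(Σ_A, ν)` is the Markov measure with initial probabilities `p_i = t_i / Σ_j t_j` and
transition probabilities `p_{ij} = t_j / t_i^q` when `A(i,j) = 1` (and `0` otherwise). -/
theorem stmt15 (m : ℕ) (hm : 2 ≤ m) (q : ℕ+) (hq : 2 ≤ (q : ℕ))
    (A : Matrix (Fin m) (Fin m) ℝ)
    (hA01 : ∀ i j, A i j = 0 ∨ A i j = 1)
    (hAprim : ∃ n : ℕ, ∀ i j, 0 < (A ^ n) i j)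
    (t : Fin m → ℝ) (ht1 : ∀ i, 1 < t i)
    (ht : ∀ i, t i ^ (q : ℕ) = ∑ j, A i j * t j) :
    ∃ μ : Measure (ℕ+ → Fin m),
      IsProbabilityMeasure μ ∧
      μ {x : ℕ+ → Fin m | ∀ k : ℕ+, A (x k) (x (k + 1)) = 1} = 1 ∧
      (∀ (n : ℕ) (u : Fin (n + 1) → Fin m),
        μ (Cyl (List.ofFn u)) =
          ENNReal.ofReal ((t (u 0) / ∑ i, t i) *
            ∏ i : Fin n,
              if A (u i.castSucc) (u i.succ) = 1 then
                t (u i.succ) / t (u i.castSucc) ^ (q : ℕ)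
              else 0)) ∧
      (∀ ν : Measure (ℕ+ → Fin m), IsProbabilityMeasure ν →
        ν {x : ℕ+ → Fin m | ∀ k : ℕ+, A (x k) (x (k + 1)) = 1} = 1 →
        sOm m q ν ≤ sOm m q μ) ∧
      (∀ ν : Measure (ℕ+ → Fin m), IsProbabilityMeasure ν →
        ν {x : ℕ+ → Fin m | ∀ k : ℕ+, A (x k) (x (k + 1)) = 1} = 1 →
        sOm m q ν = sOm m q μ → ν = μ) := by
  have hmpos : 0 < m := by omega
  have hm1 : (1 : ℝ) < m := by exact_mod_cast (by omega : 1 < m)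
  have hlogm : 0 < Real.log m := Real.log_pos hm1
  have hq2 : (2 : ℝ) ≤ (q : ℝ) := by exact_mod_cast hq
  have htp : ∀ i, 0 < t i := fun i => zero_lt_one.trans (ht1 i)
  have hne : (Finset.univ : Finset (Fin m)).Nonempty := ⟨⟨0, hmpos⟩, Finset.mem_univ _⟩
  have hTp : 0 < ∑ i, t i := Finset.sum_pos (fun i _ => htp i) hne
  set T := ∑ i, t i with hT
  let P : Fin m → Fin m → ℝ := fun i j => if A i j = 1 then t j / t i ^ (q : ℕ) else 0
  have hP : ∀ i j, 0 ≤ P i j := by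
    intro i j
    simp only [P]
    split_ifs
    · exact div_nonneg (htp j).le (pow_nonneg (htp i).le _)
    · exact le_rfl
  have hP1 : ∀ i, ∑ j, P i j = 1 := by
    intro i
    have h1 : ∀ j, P i j = A i j * t j / t i ^ (q : ℕ) := by
      intro j
      simp only [P]
      rcases hA01 i j with h | h <;> simp [h]
    simp only [h1]
    rw [← Finset.sum_div, ← ht i, div_self (pow_pos (htp i) _).ne']
  obtain ⟨μ, hμ, hcyl⟩ := exists_markov (⟨0, hmpos⟩ : Fin m) (fun i => t i / T) P
    (fun i => (div_pos (htp i) hTp).le) hP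
    (by rw [← Finset.sum_div, ← hT, div_self hTp.ne']) hP1
  -- inadmissible words
  have hval : ∀ (n : ℕ) (u : Fin (n + 1) → Fin m), (μ (Cyl (List.ofFn u))).toReal =
      t (u 0) / T * ∏ i : Fin n, P (u i.castSucc) (u i.succ) := by
    intro n u
    rw [hcyl, ENNReal.toReal_ofReal]
    exact mul_nonneg (div_pos (htp _) hTp).le (Finset.prod_nonneg fun i _ => hP _ _)
  have hbad : ∀ (n : ℕ) (u : Fin (n + 1) → Fin m),
      (∃ i : Fin n, A (u i.castSucc) (u i.succ) ≠ 1) → μ (Cyl (List.ofFn u)) = 0 := by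
    rintro n u ⟨i, hi⟩
    rw [hcyl, Finset.prod_eq_zero (Finset.mem_univ i) (by simp [P, hi])]
    simp
  have hgood : ∀ (n : ℕ) (u : Fin (n + 1) → Fin m),
      (∀ i : Fin n, A (u i.castSucc) (u i.succ) = 1) →
      0 < (μ (Cyl (List.ofFn u))).toReal ∧
      Real.log (μ (Cyl (List.ofFn u))).toReal = -Real.log T + ∑ i, Real.log (t (u i))
        - q * ∑ i : Fin n, Real.log (t (u i.castSucc)) := by
    intro n u h
    have e : (μ (Cyl (List.ofFn u))).toReal =
        t (u 0) / T * ∏ i : Fin n, (t (u i.succ) / t (u i.castSucc) ^ (q : ℕ)) := by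
      rw [hval]
      congr 1
      refine Finset.prod_congr rfl fun i _ => ?_
      simp [P, h i]
    have pos : ∀ i : Fin n, 0 < t (u i.succ) / t (u i.castSucc) ^ (q : ℕ) :=
      fun i => div_pos (htp _) (pow_pos (htp _) _)
    rw [e]
    refine ⟨mul_pos (div_pos (htp _) hTp) (Finset.prod_pos fun i _ => pos i), ?_⟩
    rw [Real.log_mul (div_pos (htp _) hTp).ne' (Finset.prod_pos fun i _ => pos i).ne',
      Real.log_div (htp _).ne' hTp.ne', Real.log_prod (fun i _ => (pos i).ne'),
      Fin.sum_univ_succ]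
    have : ∀ i : Fin n, Real.log (t (u i.succ) / t (u i.castSucc) ^ (q : ℕ)) =
        Real.log (t (u i.succ)) - q * Real.log (t (u i.castSucc)) := by
      intro i
      rw [Real.log_div (htp _).ne' (pow_pos (htp _) _).ne', Real.log_pow]
    simp only [this, Finset.sum_sub_distrib, Finset.mul_sum]
    ring
  set Ω : Set (ℕ+ → Fin m) := {x : ℕ+ → Fin m | ∀ k : ℕ+, A (x k) (x (k + 1)) = 1} with hΩ
  have hbadν : ∀ ν : Measure (ℕ+ → Fin m), IsProbabilityMeasure ν → ν Ω = 1 →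
      ∀ (n : ℕ) (u : Fin (n + 1) → Fin m),
      (∃ i : Fin n, A (u i.castSucc) (u i.succ) ≠ 1) → ν (Cyl (List.ofFn u)) = 0 := by
    rintro ν hν hνΩ n u ⟨i, hi⟩
    have hmeas : MeasurableSet (Cyl (List.ofFn u)) := by
      rw [Cyl_eq]
      exact measurable_prK m _ (measurableSet_singleton u)
    have hsub : Ω ⊆ (Cyl (List.ofFn u))ᶜ := by
      intro x hx hxu
      rw [Cyl_eq] at hxu
      have hxu : prK m (n + 1) x = u := hxu
      apply hi
      rw [← hxu]
      exact hx ⟨(i : ℕ) + 1, Nat.succ_pos _⟩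
    have h1 : ν (Cyl (List.ofFn u))ᶜ = 1 := le_antisymm prob_le_one (hνΩ ▸ measure_mono hsub)
    exact (prob_compl_eq_one_iff hmeas).1 h1
  have hμΩ : μ Ω = 1 := by
    have hae : ∀ᵐ x ∂μ, x ∈ Ω := by
      simp only [hΩ, Set.mem_ofPred_eq]
      rw [ae_all_iff]
      intro k
      have hk := k.pos
      rw [ae_iff]
      have hsub : {x : ℕ+ → Fin m | ¬ A (x k) (x (k + 1)) = 1} ⊆
          ⋃ u ∈ {u : Fin ((k : ℕ) + 1) → Fin m |
            ∃ i : Fin (k : ℕ), A (u i.castSucc) (u i.succ) ≠ 1}, Cyl (List.ofFn u) := by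
        intro x hx
        simp only [Set.mem_iUnion, Set.mem_ofPred_eq]
        refine ⟨prK m _ x, ⟨⟨(k : ℕ) - 1, by omega⟩, ?_⟩, by rw [Cyl_eq]; rfl⟩
        have e1 : (⟨(k : ℕ) - 1 + 1, Nat.succ_pos _⟩ : ℕ+) = k := PNat.eq (by simp only [PNat.mk_coe]; omega)
        have e2 : (⟨(k : ℕ) - 1 + 1 + 1, Nat.succ_pos _⟩ : ℕ+) = (k + 1 : ℕ+) :=
          PNat.eq (by simp only [PNat.mk_coe, PNat.add_coe, PNat.one_coe]; omega)
        simp only [prK, Fin.val_castSucc, Fin.val_succ, e1, e2]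
        exact hx
      refine measure_mono_null hsub ?_
      rw [measure_biUnion_null_iff (Set.to_countable _)]
      exact fun u hu => hbad _ u hu
    exact (measure_congr (Filter.eventuallyEq_univ.2 hae)).trans measure_univ
  -- cross entropy
  let c : Measure (ℕ+ → Fin m) → ℕ → ℝ := fun ν n =>
    -∑ u : Fin (n + 1) → Fin m, (ν (Cyl (List.ofFn u))).toReal *
      Real.log (μ (Cyl (List.ofFn u))).toReal
  let h : Measure (ℕ+ → Fin m) → ℕ → ℝ := fun ν n =>
    -∑ u : Fin (n + 1) → Fin m, (ν (Cyl (List.ofFn u))).toReal *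
      Real.log (ν (Cyl (List.ofFn u))).toReal
  have hc : ∀ ν : Measure (ℕ+ → Fin m), IsProbabilityMeasure ν → ν Ω = 1 →
      HasSum (fun n : ℕ => c ν n / (q : ℝ) ^ (n + 2)) (Real.log T / (q * ((q : ℝ) - 1))) := by
    intro ν hν hνΩ
    let S : (n : ℕ) → (Fin n → Fin m) → ℝ := fun n u => ∑ i, Real.log (t (u i))
    let b : ℕ → ℝ := fun n => ∫ x, S n (prK m n x) ∂ν
    have hIntegr : ∀ (n : ℕ) (g : (Fin n → Fin m) → ℝ), Integrable (fun x => g (prK m n x)) ν := by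
      intro n g
      have : IsProbabilityMeasure (ν.map (prK m n)) :=
        Measure.isProbabilityMeasure_map (measurable_prK m n).aemeasurable
      exact (Integrable.of_finite (f := g) (μ := ν.map (prK m n))).comp_measurable
        (measurable_prK m n)
    have hcb : ∀ n, c ν n = Real.log T - b (n + 1) + q * b n := by
      intro n
      have e1 : ∀ u : Fin (n + 1) → Fin m, (ν (Cyl (List.ofFn u))).toReal *
          Real.log (μ (Cyl (List.ofFn u))).toReal = (ν (Cyl (List.ofFn u))).toReal *
          (-Real.log T + S (n + 1) u - q * S n (fun i => u i.castSucc)) := by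
        intro u
        by_cases hu : ∀ i : Fin n, A (u i.castSucc) (u i.succ) = 1
        · rw [(hgood n u hu).2]
        · push Not at hu
          rw [hbadν ν hν hνΩ n u hu]
          simp
      simp only [c, e1]
      rw [sum_cyl ν (fun u : Fin (n + 1) → Fin m =>
        -Real.log T + S (n + 1) u - q * S n (fun i => u i.castSucc))]
      have i1 := hIntegr (n + 1) (S (n + 1))
      have i0 := hIntegr (n + 1) (fun u => -Real.log T + S (n + 1) u)
      have i2 := hIntegr n (S n)
      have e2 : ∀ x, (fun i : Fin n => prK m (n + 1) x i.castSucc) = prK m n x := fun x => rfl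
      simp only [e2]
      rw [integral_sub i0 (i2.const_mul _),
        integral_add (integrable_const _) i1, integral_const_mul]
      simp only [integral_const, probReal_univ, one_smul, b]
      ring
    have hC : ∃ C, ∀ i, |Real.log (t i)| ≤ C := by
      refine ⟨∑ i, |Real.log (t i)|, fun i => ?_⟩
      exact Finset.single_le_sum (f := fun i => |Real.log (t i)|) (fun i _ => abs_nonneg _)
        (Finset.mem_univ i)
    obtain ⟨C, hC⟩ := hC
    have hb : ∀ n, |b n| ≤ n * C := by
      intro n
      have := norm_integral_le_of_norm_le_const (μ := ν) (f := fun x => S n (prK m n x))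
        (C := n * C) (Filter.Eventually.of_forall fun x => by
          rw [Real.norm_eq_abs]
          refine (Finset.abs_sum_le_sum_abs _ _).trans ?_
          refine (Finset.sum_le_sum fun i _ => hC _).trans ?_
          simp)
      simpa using this
    have := hasSum_tele q hq2 (Real.log T) C b (by simp [b, S]) hb
    simpa only [hcb] using this
  have hH : ∀ (ν : Measure (ℕ+ → Fin m)) n, Hent m ν (n + 1) = h ν n / Real.log m := by
    intro ν n
    simp only [Hent, h, Real.logb, neg_div, Finset.sum_div, mul_div_assoc]
  have hs : ∀ ν : Measure (ℕ+ → Fin m),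
      sOm m q ν = ((q : ℝ) - 1) ^ 2 / Real.log m * ∑' n, h ν n / (q : ℝ) ^ (n + 2) := by
    intro ν
    have : ∀ n, Hent m ν (n + 1) / (q : ℝ) ^ (n + 2) =
        (Real.log m)⁻¹ * (h ν n / (q : ℝ) ^ (n + 2)) := by
      intro n
      rw [hH]
      ring
    simp only [sOm, this]
    rw [tsum_mul_left]
    ring
  have hg : ∀ ν : Measure (ℕ+ → Fin m), IsProbabilityMeasure ν → ν Ω = 1 → ∀ n,
      h ν n ≤ c ν n ∧ (h ν n = c ν n → ∀ u : Fin (n + 1) → Fin m,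
        (ν (Cyl (List.ofFn u))).toReal = (μ (Cyl (List.ofFn u))).toReal) := by
    intro ν hν hνΩ n
    refine gibbs (fun u : Fin (n + 1) → Fin m => (ν (Cyl (List.ofFn u))).toReal)
      (fun u => (μ (Cyl (List.ofFn u))).toReal) (fun _ => ENNReal.toReal_nonneg)
      (fun _ => ENNReal.toReal_nonneg) ?_ (by rw [sum_cyl_one, sum_cyl_one])
    intro u hu
    by_cases h' : ∀ i : Fin n, A (u i.castSucc) (u i.succ) = 1
    · exact absurd hu (hgood n u h').1.ne'
    · push Not at h'
      simp only [hbadν ν hν hνΩ n u h', ENNReal.toReal_zero]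
  have hnn : ∀ ν : Measure (ℕ+ → Fin m), IsProbabilityMeasure ν → ∀ n, 0 ≤ h ν n := by
    intro ν hν n
    simp only [h, neg_nonneg]
    refine Finset.sum_nonpos fun u _ => ?_
    exact mul_nonpos_of_nonneg_of_nonpos ENNReal.toReal_nonneg
      (Real.log_nonpos ENNReal.toReal_nonneg (ENNReal.toReal_le_of_le_ofReal zero_le_one
        (by simpa using prob_le_one)))
  have hqpow : ∀ n : ℕ, 0 < (q : ℝ) ^ n := fun n => pow_pos (by linarith) n
  have hsum : ∀ ν : Measure (ℕ+ → Fin m), IsProbabilityMeasure ν → ν Ω = 1 →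
      Summable (fun n : ℕ => h ν n / (q : ℝ) ^ (n + 2)) := by
    intro ν hν hνΩ
    refine Summable.of_nonneg_of_le (fun n => div_nonneg (hnn ν hν n) (hqpow _).le) (fun n => ?_)
      (hc ν hν hνΩ).summable
    exact div_le_div_of_nonneg_right (hg ν hν hνΩ n).1 (hqpow _).le
  have hμs : ∑' n, h μ n / (q : ℝ) ^ (n + 2) = Real.log T / (q * ((q : ℝ) - 1)) :=
    (hc μ hμ hμΩ).tsum_eq
  have hK : 0 < ((q : ℝ) - 1) ^ 2 / Real.log m := div_pos (pow_pos (by linarith) 2) hlogm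
  refine ⟨μ, hμ, hμΩ, hcyl, ?_, ?_⟩
  · intro ν hν hνΩ
    rw [hs, hs, hμs, ← (hc ν hν hνΩ).tsum_eq]
    refine mul_le_mul_of_nonneg_left ?_ hK.le
    exact (hsum ν hν hνΩ).tsum_le_tsum
      (fun n => div_le_div_of_nonneg_right (hg ν hν hνΩ n).1 (hqpow _).le)
      (hc ν hν hνΩ).summable
  · intro ν hν hνΩ he
    rw [hs, hs, hμs] at he
    have he := mul_left_cancel₀ hK.ne' he
    have h1 := (hc ν hν hνΩ).sub (hsum ν hν hνΩ).hasSum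
    rw [he, sub_self] at h1
    have h2 := (hasSum_zero_iff_of_nonneg (fun n => sub_nonneg.2
      (div_le_div_of_nonneg_right (hg ν hν hνΩ n).1 (hqpow _).le))).1 h1
    refine ext_cyl μ ν fun n u => ?_
    have h3 := congrFun h2 n
    simp only [Pi.zero_apply] at h3
    have h4 : h ν n = c ν n := by
      have := (hqpow (n + 2)).ne'
      field_simp at h3
      linarith
    exact (ENNReal.toReal_eq_toReal_iff' (measure_ne_top _ _) (measure_ne_top _ _)).1
      ((hg ν hν hνΩ n).2 h4 u)
end
end

section
/- Let X = {(x_k)_{k≥1} ∈ {0,1,2}^{ℕ⁺} : if x_k = 1 then x_{2k} = 0, and if x_k = 2 then x_{2k} = 1, for all k ≥ 1}, and let Ξ = {Σ_{k≥1} x_k 3^{-k} : (x_k) ∈ X} ⊆ [0,1]. Then the Hausdorff dimension of Ξ equals 4·log₃ t, where t is the unique real number t > 1 with t⁴ = t + 1. -/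
open scoped Classical ENNReal
open Filter MeasureTheory Topology

noncomputable section

namespace Trib

def e (a : Fin 3) : ℕ := if a = 0 then 4 else if a = 1 then 2 else 1

lemma e_le (a : Fin 3) : e a ≤ 4 := by fin_cases a <;> simp [e]

def nxt (a y : Fin 3) : Fin 3 := if a = 0 then y else if a = 1 then 0 else 1

def chain (y : ℕ → Fin 3) : ℕ → Fin 3
  | 0 => y 0
  | j + 1 => nxt (chain y j) (y (j + 1))

def ev (k : ℕ) : ℕ := k.factorization 2
def od (k : ℕ) : ℕ := k / 2 ^ (ev k)

lemma ev_od (k : ℕ) : 2 ^ ev k * od k = k := Nat.ordProj_mul_ordCompl_eq_self k 2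

lemma ev_odd {k : ℕ} (h : k % 2 = 1) : ev k = 0 :=
  Nat.factorization_eq_zero_of_not_dvd (by omega)

lemma ev_two_mul {k : ℕ} (h : 0 < k) : ev (2 * k) = ev k + 1 := by
  unfold ev
  rw [Nat.factorization_mul (by norm_num) (by omega)]
  simp [Nat.Prime.factorization Nat.prime_two, add_comm]

lemma od_two_mul {k : ℕ} (h : 0 < k) : od (2 * k) = od k := by
  unfold od
  rw [ev_two_mul h, pow_succ, mul_comm (2 ^ ev k) 2, Nat.mul_div_mul_left _ _ (by norm_num)]

lemma od_odd {k : ℕ} (h : k % 2 = 1) : od k = k := by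
  simp [od, ev_odd h]

lemma ev_pow_mul (j i : ℕ) : ev (2 ^ j * (2 * i + 1)) = j := by
  induction j with
  | zero => simp [ev_odd (show (2 * i + 1) % 2 = 1 by omega)]
  | succ j ih => rw [pow_succ', mul_assoc, ev_two_mul (by positivity), ih]

lemma od_pow_mul (j i : ℕ) : od (2 ^ j * (2 * i + 1)) = 2 * i + 1 := by
  induction j with
  | zero => simp [od_odd (show (2 * i + 1) % 2 = 1 by omega)]
  | succ j ih => rw [pow_succ', mul_assoc, od_two_mul (by positivity), ih]

def Y (ω : ℕ → ℕ → Fin 3) (k : ℕ) : Fin 3 := ω (od k) (ev k)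
def X (ω : ℕ → ℕ → Fin 3) (k : ℕ) : Fin 3 := chain (ω (od k)) (ev k)

lemma X_odd (ω) {k : ℕ} (h : k % 2 = 1) : X ω k = Y ω k := by
  simp [X, Y, ev_odd h, chain]

lemma X_even (ω) {k : ℕ} (h : 0 < k) : X ω (2 * k) = nxt (X ω k) (Y ω (2 * k)) := by
  simp [X, Y, ev_two_mul h, od_two_mul h, chain]

def Valid (z : ℕ → Fin 3) : Prop :=
  ∀ k, 0 < k → (z k = 1 → z (2 * k) = 0) ∧ (z k = 2 → z (2 * k) = 1)

lemma X_valid (ω) : Valid (X ω) := by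
  intro k hk
  rw [X_even ω hk]
  constructor <;> intro h <;> simp [h, nxt]

def S (z : ℕ → Fin 3) (n : ℕ) : ℕ := ∑ k ∈ Finset.Icc 1 n, e (z k)

lemma S_succ (z n) : S z (n + 1) = S z n + e (z (n + 1)) := by
  unfold S; rw [Finset.sum_Icc_succ_top (by omega)]

lemma S_le (z n) : S z n ≤ 4 * n := by
  induction n with
  | zero => simp [S]
  | succ n ih => rw [S_succ]; have := e_le (z (n+1)); omega

def free (z : ℕ → Fin 3) (k : ℕ) : Prop := k % 2 = 1 ∨ z (k / 2) = 0

def C (z : ℕ → Fin 3) (n : ℕ) : Set (ℕ → ℕ → Fin 3) := {ω | ∀ k ∈ Finset.Icc 1 n, X ω k = z k}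

def Fr (z : ℕ → Fin 3) (n : ℕ) : Finset ℕ := (Finset.Icc 1 n).filter (free z)

lemma C_eq {z} (hz : Valid z) (n : ℕ) : C z n = ⋂ k ∈ Fr z n, (fun ω => Y ω k) ⁻¹' {z k} := by
  ext ω
  simp only [C, Fr, Set.mem_ofPred_eq, Set.mem_iInter, Finset.mem_filter, Set.mem_preimage,
    Set.mem_singleton_iff, Finset.mem_Icc]
  constructor
  · rintro h k ⟨hk, hf⟩
    rcases Nat.even_or_odd' k with ⟨m, rfl | rfl⟩
    · rcases hf with hf | hf
      · omega
      · have h1 := h (2 * m) hk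
        rw [X_even ω (by omega), h m (by omega)] at h1
        have : 2 * m / 2 = m := by omega
        rw [this] at hf
        simpa [hf, nxt] using h1
    · rw [← h _ hk, X_odd ω (by omega)]
  · intro h k
    induction k using Nat.strong_induction_on with
    | _ k ih =>
    intro hk
    rcases Nat.even_or_odd' k with ⟨m, rfl | rfl⟩
    · have h2 : 2 * m / 2 = m := by omega
      have hm := ih m (by omega) (by omega)
      rw [X_even ω (by omega), hm]
      have hzm := hz m (by omega)
      have h3 : z m = 0 → Y ω (2 * m) = z (2 * m) := fun h0 =>
        h _ ⟨hk, Or.inr (by rw [h2]; exact h0)⟩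
      generalize z m = a at *
      fin_cases a
      · simpa [nxt] using h3 rfl
      · simpa [nxt] using (hzm.1 rfl).symm
      · simpa [nxt] using (hzm.2 rfl).symm
    · rw [X_odd ω (by omega)]
      exact h _ ⟨hk, Or.inl (by omega)⟩

lemma prod_free {t : ℝ} (ht : 0 < t) {z} (hz : Valid z) (n : ℕ) :
    ∏ k ∈ Fr z n, (t ^ e (z k) / t ^ 8) = t ^ S z n / t ^ (8 * ((n + 1) / 2) + 2 * S z (n / 2)) := by
  induction n with
  | zero => simp [Fr, S]
  | succ n ih =>
    have hstep : ∏ k ∈ Fr z (n + 1), (t ^ e (z k) / t ^ 8) =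
        (∏ k ∈ Fr z n, (t ^ e (z k) / t ^ 8)) *
          (if free z (n + 1) then t ^ e (z (n + 1)) / t ^ 8 else 1) := by
      unfold Fr
      rw [Finset.prod_filter, Finset.prod_filter, Finset.prod_Icc_succ_top (by omega)]
    rw [hstep, ih, S_succ]
    rcases Nat.even_or_odd' n with ⟨m, rfl | rfl⟩
    · have h1 : (2 * m + 1) / 2 = m := by omega
      have h2 : (2 * m + 1 + 1) / 2 = m + 1 := by omega
      have h3 : 2 * m / 2 = m := by omega
      have hf : free z (2 * m + 1) := Or.inl (by omega)
      rw [if_pos hf, h1, h2, h3]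
      field_simp
      ring
    · have h1 : (2 * m + 1) / 2 = m := by omega
      have h2 : (2 * m + 1 + 1) / 2 = m + 1 := by omega
      have h2' : (2 * m + 1 + 1 + 1) / 2 = m + 1 := by omega
      have h4 : 2 * m + 1 + 1 = 2 * (m + 1) := by ring
      rw [h1, h2', h2, S_succ z m]
      have hzm := hz (m + 1) (by omega)
      have hfr : free z (2 * m + 1 + 1) ↔ z (m + 1) = 0 := by
        unfold free; rw [h2]; constructor
        · rintro (h | h)
          · omega
          · exact h
        · exact Or.inr
      simp only [hfr]
      rw [h4]
      generalize z (m + 1) = a at *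
      fin_cases a
      · have : e 0 = 4 := by simp [e]
        simp only [Fin.zero_eta, if_true, this]
        field_simp
        ring
      · have h5 := hzm.1 rfl
        have : e 1 = 2 := by simp [e]
        have h6 : e 0 = 4 := by simp [e]
        simp only [Fin.mk_one, h5, this, h6]
        rw [if_neg (by decide)]
        field_simp
        ring
      · have h5 := hzm.2 rfl
        have : e 1 = 2 := by simp [e]
        have h6 : e 2 = 1 := by simp [e]
        simp only [Fin.reduceFinMk, h5, this, h6]
        rw [if_neg (by decide)]
        field_simp
        ring

section meas

def pm (t : ℝ) : Measure (Fin 3) := ∑ a : Fin 3, ENNReal.ofReal (t ^ e a / t ^ 8) • Measure.dirac a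

lemma pm_singleton (t : ℝ) (a : Fin 3) : pm t {a} = ENNReal.ofReal (t ^ e a / t ^ 8) := by
  simp [pm, Set.indicator_apply]

lemma pow8 {t : ℝ} (ht : t ^ 4 = t + 1) : t ^ 8 = t ^ 4 + t ^ 2 + t := by
  have : t ^ 8 = t ^ 4 * t ^ 4 := by ring
  rw [this, ht]; ring

lemma pm_prob {t : ℝ} (h0 : 1 < t) (ht : t ^ 4 = t + 1) : IsProbabilityMeasure (pm t) := by
  constructor
  have : 0 < t := by linarith
  have h8 := pow8 ht
  simp only [pm, Fin.sum_univ_three, Measure.coe_add, Measure.coe_smul, Pi.add_apply, Pi.smul_apply,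
    measure_univ, smul_eq_mul, mul_one]
  rw [← ENNReal.ofReal_add (by positivity) (by positivity),
    ← ENNReal.ofReal_add (by positivity) (by positivity)]
  rw [ENNReal.ofReal_eq_one, ← add_div, ← add_div, div_eq_one_iff_eq (by positivity), h8]
  simp [e]

abbrev PP (p : Measure (Fin 3)) [IsProbabilityMeasure p] : Measure (ℕ → ℕ → Fin 3) :=
  Measure.infinitePi (fun _ : ℕ => Measure.infinitePi (fun _ : ℕ => p))

lemma Y_meas (k : ℕ) : Measurable (fun ω => Y ω k) := by
  unfold Y; fun_prop

lemma chain_meas (j : ℕ) : Measurable (fun y => chain y j) := by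
  induction j with
  | zero => simp only [chain]; fun_prop
  | succ j ih =>
    simp only [chain]
    have : Measurable (fun q : Fin 3 × Fin 3 => nxt q.1 q.2) := measurable_of_countable _
    exact this.comp (ih.prodMk (measurable_pi_apply (j + 1)))

lemma X_meas (k : ℕ) : Measurable (fun ω => X ω k) := by
  unfold X
  exact (chain_meas _).comp (measurable_pi_apply _)

variable (p : Measure (Fin 3)) [IsProbabilityMeasure p]

lemma Y_indep : ProbabilityTheory.iIndepFun (fun k ω => Y ω k) (PP p) := by
  have h := ProbabilityTheory.iIndepFun_uncurry_infinitePi' (ι := ℕ) (κ := ℕ)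
    (X := fun _ _ (a : Fin 3) => a) (fun _ _ => p) (by fun_prop)
  have hinj : Function.Injective (fun k : ℕ => (od k, ev k)) := by
    intro a b hab
    simp only [Prod.mk.injEq] at hab
    rw [← ev_od a, ← ev_od b, hab.1, hab.2]
  exact h.precomp hinj

lemma Y_law (k : ℕ) (s : Set (Fin 3)) : PP p ((fun ω => Y ω k) ⁻¹' s) = p s := by
  have h1 := measurePreserving_eval_infinitePi (fun _ : ℕ => Measure.infinitePi (fun _ : ℕ => p)) (od k)
  have h2 := measurePreserving_eval_infinitePi (fun _ : ℕ => p) (ev k)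
  exact (h2.comp h1).measure_preimage (MeasurableSet.of_discrete).nullMeasurableSet

lemma P_C {t : ℝ} (ht : 0 < t) [IsProbabilityMeasure (pm t)] {z} (hz : Valid z) (n : ℕ) :
    PP (pm t) (C z n) =
      ENNReal.ofReal (t ^ S z n / t ^ (8 * ((n + 1) / 2) + 2 * S z (n / 2))) := by
  rw [C_eq hz, (Y_indep (pm t)).measure_inter_preimage_eq_mul _ (fun _ _ => MeasurableSet.of_discrete)]
  simp only [Y_law, pm_singleton]
  rw [← ENNReal.ofReal_prod_of_nonneg (fun _ _ => by positivity), prod_free ht hz]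

lemma slln (j : ℕ) : ∀ᵐ ω ∂(PP p), ∃ a : ℝ, Tendsto (fun n : ℕ =>
    (∑ i ∈ Finset.range n, (e (X ω (2 ^ j * (2 * i + 1))) : ℝ)) / n) atTop (𝓝 a) := by
  have key := ProbabilityTheory.strong_law_ae_real (μ := PP p)
    (fun i ω => (e (chain (ω (2 * i + 1)) j) : ℝ)) ?_ ?_ ?_
  · filter_upwards [key] with ω hω
    simp only [X, od_pow_mul, ev_pow_mul]
    exact ⟨_, hω⟩
  · have hm : Measurable (fun ω : ℕ → ℕ → Fin 3 => (e (chain (ω (2 * 0 + 1)) j) : ℝ)) :=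
      (measurable_of_countable (fun a : Fin 3 => (e a : ℝ))).comp
        ((chain_meas j).comp (measurable_pi_apply _))
    refine Integrable.of_bound hm.aestronglyMeasurable 4 (Eventually.of_forall fun ω => ?_)
    simp only [Real.norm_natCast]
    exact_mod_cast e_le _
  · have h := ProbabilityTheory.iIndepFun_infinitePi (ι := ℕ)
      (P := fun _ : ℕ => Measure.infinitePi (fun _ : ℕ => p))
      (X := fun _ y => (e (chain y j) : ℝ))
      (fun _ => (measurable_of_countable (fun a : Fin 3 => (e a : ℝ))).comp (chain_meas j))
    intro a b hab
    exact h.indepFun (i := 2 * a + 1) (j := 2 * b + 1) (by omega)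
  · intro i
    have hg : Measurable (fun y : ℕ → Fin 3 => (e (chain y j) : ℝ)) :=
      (measurable_of_countable (fun a : Fin 3 => (e a : ℝ))).comp (chain_meas j)
    have hi := measurePreserving_eval_infinitePi (fun _ : ℕ => Measure.infinitePi (fun _ : ℕ => p)) (2 * i + 1)
    have h0 := measurePreserving_eval_infinitePi (fun _ : ℕ => Measure.infinitePi (fun _ : ℕ => p)) (2 * 0 + 1)
    have hd : ProbabilityTheory.IdentDistrib (Function.eval (2 * i + 1)) (Function.eval (2 * 0 + 1))
      (PP p) (PP p) := ⟨hi.measurable.aemeasurable, h0.measurable.aemeasurable, by rw [hi.map_eq, h0.map_eq]⟩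
    exact hd.comp hg

end meas

section det

def Sj (z : ℕ → Fin 3) (j n : ℕ) : ℝ := ∑ k ∈ Finset.Icc 1 n, (e (z (2 ^ j * k)) : ℝ)

def B (z : ℕ → Fin 3) (j n : ℕ) : ℝ := ∑ i ∈ Finset.range n, (e (z (2 ^ j * (2 * i + 1))) : ℝ)

lemma Sj_succ (z j n) : Sj z j (n + 1) = Sj z j n + e (z (2 ^ j * (n + 1))) := by
  unfold Sj; rw [Finset.sum_Icc_succ_top (by omega)]

lemma B_succ (z j n) : B z j (n + 1) = B z j n + e (z (2 ^ j * (2 * n + 1))) := by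
  unfold B; rw [Finset.sum_range_succ]

lemma Sj_nonneg (z j n) : 0 ≤ Sj z j n := Finset.sum_nonneg fun _ _ => by positivity

lemma Sj_le (z j n) : Sj z j n ≤ 4 * n := by
  induction n with
  | zero => simp [Sj]
  | succ n ih =>
    rw [Sj_succ]
    have : (e (z (2 ^ j * (n + 1))) : ℝ) ≤ 4 := by exact_mod_cast e_le _
    push_cast; linarith

lemma Sj_rec (z j n) : Sj z j n = B z j ((n + 1) / 2) + Sj z (j + 1) (n / 2) := by
  induction n with
  | zero => simp [Sj, B]
  | succ n ih =>
    rw [Sj_succ, ih]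
    rcases Nat.even_or_odd' n with ⟨m, rfl | rfl⟩
    · have h1 : (2 * m + 1) / 2 = m := by omega
      have h2 : (2 * m + 1 + 1) / 2 = m + 1 := by omega
      have h3 : 2 * m / 2 = m := by omega
      rw [h1, h2, h3, B_succ]; ring
    · have h1 : (2 * m + 1) / 2 = m := by omega
      have h2 : (2 * m + 1 + 1) / 2 = m + 1 := by omega
      have h2' : (2 * m + 1 + 1 + 1) / 2 = m + 1 := by omega
      rw [h1, h2', h2, Sj_succ]
      have : 2 ^ j * (2 * m + 1 + 1) = 2 ^ (j + 1) * (m + 1) := by ring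
      rw [this]; ring

lemma B_dev {z j} {a : ℝ} (h : Tendsto (fun n : ℕ => B z j n / n) atTop (𝓝 a)) {δ : ℝ} (hδ : 0 < δ) :
    ∀ᶠ n : ℕ in atTop, |B z j ((n + 1) / 2) - 2 * B z j ((n / 2 + 1) / 2)| ≤ δ * n := by
  have h1 : ∀ᶠ m : ℕ in atTop, |B z j m - a * m| ≤ δ / 4 * m := by
    have := (Metric.tendsto_nhds.1 h) (δ / 4) (by positivity)
    filter_upwards [this, eventually_gt_atTop 0] with m hm hm0
    have hm' : (0 : ℝ) < m := by exact_mod_cast hm0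
    rw [Real.dist_eq] at hm
    have : B z j m - a * m = (B z j m / m - a) * m := by field_simp
    rw [this, abs_mul, abs_of_pos hm']
    exact mul_le_mul_of_nonneg_right hm.le hm'.le
  obtain ⟨M, hM⟩ := eventually_atTop.1 h1
  obtain ⟨K, hK⟩ := exists_nat_gt ((δ + |a|) / (δ / 2))
  filter_upwards [eventually_ge_atTop (4 * M + 4), eventually_ge_atTop K] with n hn hnK
  have e1 := hM ((n + 1) / 2) (by omega)
  have e2 := hM ((n / 2 + 1) / 2) (by omega)
  set u := (n + 1) / 2 with hu
  set v := (n / 2 + 1) / 2 with hv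
  have c1 : 2 * u ≤ n + 1 := by omega
  have c2 : 4 * v ≤ n + 2 := by omega
  have c3 : (u : ℤ) - 2 * v ≤ 1 := by omega
  have c4 : -1 ≤ (u : ℤ) - 2 * v := by omega
  have c1' : 2 * (u : ℝ) ≤ n + 1 := by exact_mod_cast c1
  have c2' : 4 * (v : ℝ) ≤ n + 2 := by exact_mod_cast c2
  have c3' : (u : ℝ) - 2 * v ≤ 1 := by exact_mod_cast c3
  have c4' : -1 ≤ (u : ℝ) - 2 * v := by exact_mod_cast c4
  have e3 : |a * ((u : ℝ) - 2 * v)| ≤ |a| := by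
    rw [abs_mul]
    exact mul_le_of_le_one_right (abs_nonneg _) (abs_le.2 ⟨c4', c3'⟩)
  have e4 : δ + |a| ≤ δ / 2 * n := by
    have : (δ + |a|) / (δ / 2) ≤ n := hK.le.trans (by exact_mod_cast hnK)
    rw [div_le_iff₀ (by positivity)] at this
    linarith
  rw [abs_le] at e1 e2 e3 ⊢
  constructor <;> nlinarith

lemma dev_aux {z} (h : ∀ j, ∃ a : ℝ, Tendsto (fun n : ℕ => B z j n / n) atTop (𝓝 a)) (m : ℕ) :
    ∀ δ > 0, ∀ j, ∀ᶠ n : ℕ in atTop, |Sj z j n - 2 * Sj z j (n / 2)| ≤ (16 / 2 ^ m + δ) * n := by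
  induction m with
  | zero =>
    intro δ hδ j
    refine Eventually.of_forall fun n => ?_
    have h1 := Sj_nonneg z j n
    have h2 := Sj_nonneg z j (n / 2)
    have h3 := Sj_le z j n
    have h4 := Sj_le z j (n / 2)
    have h5 : ((n / 2 : ℕ) : ℝ) ≤ n := by exact_mod_cast Nat.div_le_self _ _
    have h6 : 0 ≤ δ * n := by positivity
    have h7 : (0 : ℝ) ≤ n := by positivity
    rw [abs_le]; constructor <;> norm_num <;> nlinarith
  | succ m ih =>
    intro δ hδ j
    obtain ⟨a, ha⟩ := h j
    have h1 := B_dev ha (show 0 < δ / 2 by positivity)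
    have htd : Tendsto (fun n : ℕ => n / 2) atTop atTop := Nat.tendsto_div_const_atTop (by norm_num)
    have h2 := htd.eventually (ih δ hδ (j + 1))
    filter_upwards [h1, h2] with n h1 h2
    rw [Sj_rec z j n, Sj_rec z j (n / 2)]
    have h3 : 2 * ((n / 2 : ℕ) : ℝ) ≤ n := by exact_mod_cast (by omega : 2 * (n / 2) ≤ n)
    have h4 : (16 / 2 ^ m + δ) * ((n / 2 : ℕ) : ℝ) ≤ (16 / 2 ^ m + δ) * (n / 2) := by
      apply mul_le_mul_of_nonneg_left _ (by positivity); linarith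
    have h5 : (16 / 2 ^ (m + 1) + δ) * (n : ℝ) = (16 / 2 ^ m + δ) * (n / 2) + δ / 2 * n := by
      field_simp; ring
    rw [h5]
    rw [abs_le] at h1 h2 ⊢
    constructor <;> linarith [h1.1, h1.2, h2.1, h2.2]

lemma dev {z} (h : ∀ j, ∃ a : ℝ, Tendsto (fun n : ℕ => B z j n / n) atTop (𝓝 a)) {δ : ℝ} (hδ : 0 < δ) :
    ∀ᶠ n : ℕ in atTop, (S z n : ℝ) - 2 * S z (n / 2) ≤ δ * n := by
  obtain ⟨m, hm⟩ := exists_pow_lt_of_lt_one (show 0 < δ / 32 by positivity) (show (1 / 2 : ℝ) < 1 by norm_num)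
  filter_upwards [dev_aux h m (δ / 2) (by positivity) 0] with n hn
  have e1 : ∀ n, (S z n : ℝ) = Sj z 0 n := by intro n; simp [S, Sj]
  rw [e1, e1]
  refine (le_abs_self _).trans (hn.trans ?_)
  apply mul_le_mul_of_nonneg_right _ (by positivity)
  have : (16 : ℝ) / 2 ^ m = 16 * (1 / 2) ^ m := by rw [one_div, inv_pow]; rfl
  rw [this]; linarith

/-- along powers of two, the deviation is infinitely often almost nonnegative -/
lemma dev_pow (z : ℕ → Fin 3) {δ : ℝ} (hδ : 0 < δ) (L : ℕ) :
    ∃ l, L ≤ l ∧ -(δ * (2 ^ (l + 1) : ℕ)) ≤ (S z (2 ^ (l + 1)) : ℝ) - 2 * S z (2 ^ (l + 1) / 2) := by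
  by_contra! hcon
  have key : ∀ m, (S z (2 ^ (L + m)) : ℝ) / 2 ^ (L + m) ≤ 4 - δ * m := by
    intro m
    induction m with
    | zero =>
      rw [div_le_iff₀ (by positivity)]
      have : (S z (2 ^ L) : ℝ) ≤ 4 * (2 ^ L : ℕ) := by exact_mod_cast S_le z (2 ^ L)
      simpa using this
    | succ m ih =>
      have h1 := hcon (L + m) (by omega)
      have h2 : 2 ^ (L + m + 1) / 2 = 2 ^ (L + m) := by rw [pow_succ]; omega
      rw [h2] at h1
      rw [div_le_iff₀ (by positivity)] at ih ⊢
      rw [← add_assoc]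
      push_cast at h1 ⊢
      have h3 : (2 : ℝ) ^ (L + m + 1) = 2 ^ (L + m) * 2 := pow_succ _ _
      rw [h3] at h1 ⊢
      nlinarith
  obtain ⟨m, hm⟩ := exists_nat_gt (4 / δ)
  have h1 := key m
  rw [div_lt_iff₀ hδ] at hm
  have h2 : 0 ≤ (S z (2 ^ (L + m)) : ℝ) / 2 ^ (L + m) := by positivity
  linarith

end det

section code

def code (z : ℕ → Fin 3) : ℕ → ℕ
  | 0 => 0
  | n + 1 => 3 * code z n + (z (n + 1) : ℕ)

lemma code_inj {z w : ℕ → Fin 3} {n : ℕ} (h : code z n = code w n) :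
    ∀ k ∈ Finset.Icc 1 n, z k = w k := by
  induction n with
  | zero => intro k hk; simp at hk
  | succ n ih =>
    simp only [code] at h
    have h1 := (z (n + 1)).isLt
    have h2 := (w (n + 1)).isLt
    intro k hk
    rw [Finset.mem_Icc] at hk
    rcases Nat.lt_or_ge n k with hkn | hkn
    · have : k = n + 1 := by omega
      subst this
      apply Fin.ext; omega
    · exact ih (by omega) k (Finset.mem_Icc.2 ⟨hk.1, hkn⟩)

lemma code_congr {z w : ℕ → Fin 3} {n : ℕ} (h : ∀ k ∈ Finset.Icc 1 n, z k = w k) :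
    code z n = code w n := by
  induction n with
  | zero => rfl
  | succ n ih =>
    simp only [code]
    rw [ih fun k hk => h k (by rw [Finset.mem_Icc] at *; omega), h (n + 1) (by simp)]

/-- the event that the code of the first `n` digits is `a`. -/
def Cc (n a : ℕ) : Set (ℕ → ℕ → Fin 3) := {ω | code (X ω) n = a}

lemma Cc_eq (z : ℕ → Fin 3) (n : ℕ) : Cc n (code z n) = C z n := by
  ext ω
  exact ⟨fun h => code_inj h, fun h => code_congr h⟩

lemma code_meas (n : ℕ) : Measurable (fun ω => code (X ω) n) := by
  induction n with
  | zero => simp only [code]; fun_prop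
  | succ n ih =>
    simp only [code]
    exact (ih.const_mul 3).add ((measurable_of_countable (fun a : Fin 3 => (a : ℕ))).comp (X_meas _))

lemma Cc_meas (n a : ℕ) : MeasurableSet (Cc n a) :=
  code_meas n (MeasurableSet.singleton a)

lemma Cc_disj (n : ℕ) : Pairwise (Function.onFun Disjoint (Cc n)) := by
  intro a b hab
  rw [Function.onFun, Set.disjoint_left]
  intro ω h1 h2
  exact hab (h1.symm.trans h2)

lemma Cc_sum (p : Measure (Fin 3)) [IsProbabilityMeasure p] (n : ℕ) : ∑' a, PP p (Cc n a) ≤ 1 := by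
  rw [← measure_iUnion (Cc_disj n) (Cc_meas n)]
  exact prob_le_one

def tv (z : ℕ → Fin 3) (n : ℕ) : ℝ := ∑' k : ℕ, ((z (n + k + 1) : ℕ) : ℝ) * (3 : ℝ)⁻¹ ^ (k + 1)

lemma tv_term_le (z : ℕ → Fin 3) (m k : ℕ) :
    ((z m : ℕ) : ℝ) * (3 : ℝ)⁻¹ ^ (k + 1) ≤ 2 / 3 * (3 : ℝ)⁻¹ ^ k := by
  have h : ((z m : ℕ) : ℝ) ≤ 2 := by exact_mod_cast (by have := (z m).isLt; omega : (z m : ℕ) ≤ 2)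
  rw [pow_succ]
  have : (0 : ℝ) ≤ (3 : ℝ)⁻¹ ^ k := by positivity
  nlinarith

lemma geo : HasSum (fun k : ℕ => 2 / 3 * (3 : ℝ)⁻¹ ^ k) 1 := by
  have := (hasSum_geometric_of_lt_one (show (0:ℝ) ≤ 3⁻¹ by norm_num) (by norm_num)).mul_left (2 / 3)
  convert! this using 1
  norm_num

lemma tv_summable (z : ℕ → Fin 3) (n : ℕ) :
    Summable (fun k : ℕ => ((z (n + k + 1) : ℕ) : ℝ) * (3 : ℝ)⁻¹ ^ (k + 1)) :=
  Summable.of_nonneg_of_le (fun _ => by positivity) (fun k => tv_term_le z _ k) geo.summable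

lemma tv_nonneg (z n) : 0 ≤ tv z n := tsum_nonneg fun _ => by positivity

lemma tv_le (z n) : tv z n ≤ 1 := by
  rw [← geo.tsum_eq]
  exact (tv_summable z n).tsum_le_tsum (fun k => tv_term_le z _ k) geo.summable

lemma tv_rec (z n) : 3 * tv z n = (z (n + 1) : ℕ) + tv z (n + 1) := by
  unfold tv
  rw [(tv_summable z n).tsum_eq_zero_add, mul_add, ← tsum_mul_left]
  congr 1
  · simp; ring
  · congr 1; ext k
    rw [show n + (k + 1) + 1 = n + 1 + k + 1 by ring]
    rw [pow_succ _ (k + 1)]; ring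

lemma tv_code (z n) : 3 ^ n * tv z 0 = code z n + tv z n := by
  induction n with
  | zero => simp [code]
  | succ n ih =>
    rw [pow_succ', mul_assoc, ih, mul_add, tv_rec]
    simp only [code]; push_cast; ring

lemma valMap_eq (x : ℕ+ → Fin 3) (z : ℕ → Fin 3) (h : ∀ k : ℕ+, x k = z k) :
    ValMap 3 x = tv z 0 := by
  unfold ValMap tv
  have := tsum_pnat_eq_tsum_succ (f := fun k => ((z k : ℕ) : ℝ) * (3 : ℝ)⁻¹ ^ k)
  simp only [h, zero_add]
  exact_mod_cast this

def Xi : Set ℝ := {r | ∃ z, Valid z ∧ r = tv z 0}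

lemma XiSet_eq : XiSet {x : ℕ+ → Fin 3 | ∀ k : ℕ+,
        (x k = 1 → x (2 * k) = 0) ∧ (x k = 2 → x (2 * k) = 1)} = Xi := by
  ext r
  constructor
  · rintro ⟨x, hx, rfl⟩
    refine ⟨fun k => if h : 0 < k then x ⟨k, h⟩ else 0, ?_, ?_⟩
    · intro k hk
      have := hx ⟨k, hk⟩
      have h2 : 0 < 2 * k := by omega
      simp only [hk, h2, dif_pos]
      exact this
    · apply valMap_eq
      intro k
      simp only [k.pos, dif_pos]
      rfl
  · rintro ⟨z, hz, rfl⟩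
    refine ⟨fun k => z k, ?_, ?_⟩
    · intro k
      have := hz k k.pos
      simpa using this
    · exact (valMap_eq _ z fun k => rfl).symm

end code

section upper

lemma c_pos {t : ℝ} (h1 : 1 < t) : 0 < Real.logb 3 t := Real.logb_pos (by norm_num) h1

lemma P_C' {t : ℝ} (ht : 1 < t) [IsProbabilityMeasure (pm t)] {z} (hz : Valid z) (n : ℕ) :
    PP (pm t) (C z n) =
      ENNReal.ofReal ((3 : ℝ) ^ (Real.logb 3 t *
        ((S z n : ℝ) - 2 * S z (n / 2) - 8 * ((n + 1) / 2 : ℕ)))) := by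
  have h0 : 0 < t := by linarith
  rw [P_C h0 hz]
  congr 1
  rw [Real.rpow_mul (by norm_num), Real.rpow_logb (by norm_num) (by norm_num) h0]
  rw [← Real.rpow_natCast, ← Real.rpow_natCast, ← Real.rpow_sub h0]
  congr 1
  push_cast; ring

def good (δ : ℝ) (n a : ℕ) : Prop :=
  ∃ z, Valid z ∧ code z n = a ∧ -(δ * n) ≤ (S z n : ℝ) - 2 * S z (n / 2)

def U (δ : ℝ) (L : ℕ) (q : ℕ × ℕ) : Set ℝ :=
  if L ≤ q.1 ∧ good δ (2 ^ (q.1 + 1)) q.2 then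
    Set.Icc ((q.2 : ℝ) / 3 ^ (2 ^ (q.1 + 1))) ((q.2 + 1 : ℝ) / 3 ^ (2 ^ (q.1 + 1)))
  else ∅

lemma ediam_cell (n a : ℕ) : Metric.ediam (Set.Icc ((a : ℝ) / 3 ^ n) ((a + 1 : ℝ) / 3 ^ n)) =
    ENNReal.ofReal ((3 : ℝ)⁻¹ ^ n) := by
  rw [Real.ediam_Icc]
  congr 1
  rw [← sub_div, inv_pow]; simp

lemma le_two_pow (l : ℕ) : l ≤ 2 ^ (l + 1) := by
  have : l < 2 ^ l := Nat.lt_two_pow_self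
  rw [pow_succ]; omega

lemma U_diam (δ L q) : Metric.ediam (U δ L q) ≤ ENNReal.ofReal ((3 : ℝ)⁻¹ ^ L) := by
  unfold U
  split_ifs with h
  · rw [ediam_cell]
    apply ENNReal.ofReal_le_ofReal
    exact pow_le_pow_of_le_one (by norm_num) (by norm_num) (h.1.trans (le_two_pow _))
  · simp

lemma U_cover {δ : ℝ} (hδ : 0 < δ) (L : ℕ) : Xi ⊆ ⋃ q, U δ L q := by
  rintro r ⟨z, hz, rfl⟩
  obtain ⟨l, hl, hd⟩ := dev_pow z hδ L
  rw [Set.mem_iUnion]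
  refine ⟨(l, code z (2 ^ (l + 1))), ?_⟩
  unfold U
  rw [if_pos ⟨hl, z, hz, rfl, hd⟩]
  have h1 := tv_code z (2 ^ (l + 1))
  have h2 := tv_nonneg z (2 ^ (l + 1))
  have h3 := tv_le z (2 ^ (l + 1))
  constructor
  · rw [div_le_iff₀ (by positivity)]; linarith
  · rw [le_div_iff₀ (by positivity)]; linarith

lemma upper {t : ℝ} (ht : 1 < t) [IsProbabilityMeasure (pm t)] (d : NNReal)
    (hd : 4 * Real.logb 3 t < d) : μH[(d : ℝ)] Xi ≠ ⊤ := by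
  set c := Real.logb 3 t with hc
  have hc0 : 0 < c := c_pos ht
  have hd0 : (0 : ℝ) < d := by linarith
  set δ : ℝ := (d - 4 * c) / (2 * c) with hδ
  have hδ0 : 0 < δ := div_pos (by linarith) (by linarith)
  have hδc : δ * c = (d - 4 * c) / 2 := by rw [hδ]; field_simp
  set ρ : ℝ := (3 : ℝ) ^ ((4 * c - d) / 2) with hρ
  have hρ0 : 0 < ρ := by positivity
  have hρ1 : ρ < 1 := Real.rpow_lt_one_of_one_lt_of_neg (by norm_num) (by linarith)
  have hcell : ∀ L q, Metric.ediam (U δ L q) ^ (d : ℝ) ≤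
      ENNReal.ofReal (ρ ^ q.1) * PP (pm t) (Cc (2 ^ (q.1 + 1)) q.2) := by
    rintro L ⟨l, a⟩
    unfold U
    split_ifs with h
    · simp only at h ⊢
      obtain ⟨-, z, hz, rfl, hdev⟩ := h
      rw [ediam_cell, Cc_eq, P_C' ht hz, ← hc, ← ENNReal.ofReal_mul (by positivity),
        ENNReal.ofReal_rpow_of_nonneg (by positivity) hd0.le]
      apply ENNReal.ofReal_le_ofReal
      set n := 2 ^ (l + 1) with hn
      have hn2 : 8 * ((n + 1) / 2) = 4 * n := by
        have : n = 2 * 2 ^ l := by rw [hn, pow_succ']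
        omega
      have hn2' : (8 : ℝ) * ((n + 1) / 2 : ℕ) = 4 * n := by exact_mod_cast hn2
      rw [hn2']
      have h1 : ρ ^ n ≤ ρ ^ l := pow_le_pow_of_le_one hρ0.le hρ1.le (le_two_pow l)
      have h2 : ((3 : ℝ)⁻¹ ^ n) ^ (d : ℝ) = (3 : ℝ) ^ (-(n * d) : ℝ) := by
        rw [Real.rpow_neg (by norm_num), Real.rpow_mul (by norm_num), Real.rpow_natCast, inv_pow,
          Real.inv_rpow (by positivity)]
      have h3 : ρ ^ n = (3 : ℝ) ^ ((4 * c - d) / 2 * n) := by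
        rw [Real.rpow_mul (by norm_num), Real.rpow_natCast]
      rw [h2]
      refine le_trans ?_ (mul_le_mul_of_nonneg_right h1 (by positivity))
      rw [h3, ← Real.rpow_add (by norm_num)]
      apply Real.rpow_le_rpow_of_exponent_le (by norm_num)
      have h4 : c * (-(δ * n)) ≤ c * ((S z n : ℝ) - 2 * S z (n / 2)) :=
        mul_le_mul_of_nonneg_left hdev hc0.le
      have h5 : c * (-(δ * n)) = -((d - 4 * c) / 2) * n := by rw [← hδc]; ring
      rw [h5] at h4
      nlinarith
    · simp [hd0]
  have hsum : ∀ L, ∑' q, Metric.ediam (U δ L q) ^ (d : ℝ) ≤ ∑' l : ℕ, ENNReal.ofReal (ρ ^ l) := by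
    intro L
    refine (ENNReal.tsum_le_tsum (hcell L)).trans ?_
    rw [ENNReal.tsum_prod']
    refine ENNReal.tsum_le_tsum fun l => ?_
    simp only
    rw [ENNReal.tsum_mul_left]
    exact mul_le_of_le_one_right (by positivity) (Cc_sum (pm t) _)
  have hfin : ∑' l : ℕ, ENNReal.ofReal (ρ ^ l) ≠ ⊤ :=
    (summable_geometric_of_lt_one hρ0.le hρ1).tsum_ofReal_ne_top
  have hlim : Tendsto (fun L : ℕ => ENNReal.ofReal ((3 : ℝ)⁻¹ ^ L)) atTop (𝓝 0) := by
    rw [← ENNReal.ofReal_zero]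
    exact ENNReal.tendsto_ofReal (tendsto_pow_atTop_nhds_zero_of_lt_one (by norm_num) (by norm_num))
  have := Measure.hausdorffMeasure_le_liminf_tsum (d : ℝ) Xi (l := atTop)
    (fun L : ℕ => ENNReal.ofReal ((3 : ℝ)⁻¹ ^ L)) hlim (fun L => U δ L)
    (Eventually.of_forall fun L q => U_diam δ L q) (Eventually.of_forall fun L => U_cover hδ0 L)
  refine ne_top_of_le_ne_top hfin (this.trans ?_)
  refine (liminf_le_liminf (Eventually.of_forall hsum)).trans ?_
  simp

end upper

section lower

def EN (δ : ℝ) (N : ℕ) : Set (ℕ → ℕ → Fin 3) :=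
  {ω | ∀ n, N ≤ n → (S (X ω) n : ℝ) - 2 * S (X ω) (n / 2) ≤ δ * n}

lemma exists_EN (p : Measure (Fin 3)) [IsProbabilityMeasure p] {δ : ℝ} (hδ : 0 < δ) :
    ∃ N, PP p (EN δ N) ≠ 0 := by
  by_contra! hcon
  have h1 : PP p (⋃ N, EN δ N) = 0 := measure_iUnion_null hcon
  have h2 : ∀ᵐ ω ∂(PP p), ω ∈ ⋃ N, EN δ N := by
    filter_upwards [ae_all_iff.2 (slln p)] with ω hω
    obtain ⟨N, hN⟩ := eventually_atTop.1 (dev (z := X ω) hω hδ)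
    exact Set.mem_iUnion.2 ⟨N, hN⟩
  have h3 : ∀ᵐ ω ∂(PP p), ω ∉ ⋃ N, EN δ N := measure_eq_zero_iff_ae_notMem.1 h1
  obtain ⟨ω, ha, hb⟩ := (h2.and h3).exists
  exact hb ha

lemma mass {t : ℝ} (ht : 1 < t) [IsProbabilityMeasure (pm t)] {d δ : ℝ}
    (hδ : Real.logb 3 t * (4 - δ) = d) {N n : ℕ} (hn : N ≤ n) (s : Set ℝ)
    (hs : Metric.ediam s ≤ ENNReal.ofReal ((3 : ℝ)⁻¹ ^ n)) :
    PP (pm t) ((fun ω => tv (X ω) 0) ⁻¹' s ∩ EN δ N) ≤ ENNReal.ofReal (5 * (3 : ℝ) ^ (-(d * n))) := by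
  rcases Set.eq_empty_or_nonempty ((fun ω => tv (X ω) 0) ⁻¹' s ∩ EN δ N) with h | ⟨ω₀, h₀, -⟩
  · rw [h]; simp
  set a₀ := code (X ω₀) n with ha₀
  have hsub : (fun ω => tv (X ω) 0) ⁻¹' s ∩ EN δ N ⊆
      ⋃ a ∈ Finset.Icc (a₀ - 2) (a₀ + 2), (Cc n a ∩ EN δ N) := by
    rintro ω ⟨hω, hE⟩
    simp only [Set.mem_iUnion]
    refine ⟨code (X ω) n, ?_, rfl, hE⟩
    have h1 : edist (tv (X ω) 0) (tv (X ω₀) 0) ≤ ENNReal.ofReal ((3 : ℝ)⁻¹ ^ n) :=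
      (Metric.edist_le_ediam_of_mem (s := s) hω h₀).trans hs
    rw [edist_dist, ENNReal.ofReal_le_ofReal_iff (by positivity), Real.dist_eq] at h1
    have e1 := tv_code (X ω) n
    have e2 := tv_code (X ω₀) n
    have e3 := tv_nonneg (X ω) n
    have e4 := tv_le (X ω) n
    have e5 := tv_nonneg (X ω₀) n
    have e6 := tv_le (X ω₀) n
    have e7 : |3 ^ n * tv (X ω) 0 - 3 ^ n * tv (X ω₀) 0| ≤ 1 := by
      rw [← mul_sub, abs_mul, abs_of_pos (by positivity : (0 : ℝ) < 3 ^ n)]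
      calc _ ≤ (3 : ℝ) ^ n * (3 : ℝ)⁻¹ ^ n := by gcongr
        _ = 1 := by rw [← mul_pow]; norm_num
    rw [e1, e2, abs_le] at e7
    have f1 : (code (X ω) n : ℝ) ≤ a₀ + 2 := by linarith [e7.2]
    have f2 : (a₀ : ℝ) ≤ code (X ω) n + 2 := by linarith [e7.1]
    have f1' : code (X ω) n ≤ a₀ + 2 := by exact_mod_cast f1
    have f2' : a₀ ≤ code (X ω) n + 2 := by exact_mod_cast f2
    rw [Finset.mem_Icc]; omega
  have hcell : ∀ a, PP (pm t) (Cc n a ∩ EN δ N) ≤ ENNReal.ofReal ((3 : ℝ) ^ (-(d * n))) := by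
    intro a
    rcases Set.eq_empty_or_nonempty (Cc n a ∩ EN δ N) with h | ⟨ω, h1, h2⟩
    · rw [h]; simp
    refine (measure_mono Set.inter_subset_left).trans ?_
    have h1' : code (X ω) n = a := h1
    rw [← h1', Cc_eq, P_C' ht (X_valid ω)]
    apply ENNReal.ofReal_le_ofReal
    apply Real.rpow_le_rpow_of_exponent_le (by norm_num)
    have h3 := h2 n hn
    have h4 : (4 : ℝ) * n ≤ 8 * ((n + 1) / 2 : ℕ) := by
      exact_mod_cast (by omega : 4 * n ≤ 8 * ((n + 1) / 2))
    have := c_pos ht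
    calc _ ≤ Real.logb 3 t * (δ * n - 4 * n) := by
          apply mul_le_mul_of_nonneg_left _ this.le; linarith
      _ = _ := by rw [← hδ]; ring
  refine (measure_mono hsub).trans ((measure_biUnion_finset_le _ _).trans ?_)
  refine (Finset.sum_le_sum fun a _ => hcell a).trans ?_
  rw [Finset.sum_const, nsmul_eq_mul, ENNReal.ofReal_mul (by norm_num)]
  gcongr
  rw [Nat.card_Icc]
  have : (ENNReal.ofReal 5) = ((5 : ℕ) : ℝ≥0∞) := by simp
  rw [this]
  exact_mod_cast (by omega : a₀ + 2 + 1 - (a₀ - 2) ≤ 5)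

lemma lower {t : ℝ} (ht : 1 < t) [IsProbabilityMeasure (pm t)] (d : NNReal) (hd0 : 0 < d)
    (hd : (d : ℝ) < 4 * Real.logb 3 t) : μH[(d : ℝ)] Xi ≠ 0 := by
  have hc := c_pos ht
  have hd0' : (0 : ℝ) < d := hd0
  set δ : ℝ := 4 - d / Real.logb 3 t with hδ
  have hδ0 : 0 < δ := by
    rw [hδ, sub_pos, div_lt_iff₀ hc]; exact hd
  have hδd : Real.logb 3 t * (4 - δ) = d := by
    rw [hδ]; field_simp; ring
  obtain ⟨N, hN⟩ := exists_EN (pm t) hδ0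
  set K : ℝ := 5 * (3 : ℝ) ^ (d : ℝ) with hK
  have hK0 : 0 < K := by positivity
  set m : OuterMeasure ℝ := OuterMeasure.map (fun ω => tv (X ω) 0)
    (OuterMeasure.restrict (EN δ N) (PP (pm t)).toOuterMeasure) with hm
  have hmv : ∀ s, m s = PP (pm t) ((fun ω => tv (X ω) 0) ⁻¹' s ∩ EN δ N) := by
    intro s; simp [hm]
  have hbound : ∀ s, Metric.ediam s ≤ ENNReal.ofReal ((3 : ℝ)⁻¹ ^ N) →
      m s ≤ ENNReal.ofReal K * Metric.ediam s ^ (d : ℝ) := by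
    intro s hs
    rw [hmv]
    rcases eq_or_ne (Metric.ediam s) 0 with h0 | h0
    · have hall : ∀ n, N ≤ n → PP (pm t) ((fun ω => tv (X ω) 0) ⁻¹' s ∩ EN δ N) ≤
          ENNReal.ofReal (5 * (3 : ℝ) ^ (-(d * n : ℝ))) := fun n hn =>
        mass ht hδd hn s (by rw [h0]; exact zero_le)
      have hlim : Tendsto (fun n : ℕ => ENNReal.ofReal (5 * (3 : ℝ) ^ (-(d * n : ℝ)))) atTop (𝓝 0) := by
        rw [← ENNReal.ofReal_zero]
        apply ENNReal.tendsto_ofReal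
        have h1 : Tendsto (fun n : ℕ => ((3 : ℝ) ^ (-(d : ℝ))) ^ n) atTop (𝓝 0) :=
          tendsto_pow_atTop_nhds_zero_of_lt_one (by positivity)
            (Real.rpow_lt_one_of_one_lt_of_neg (by norm_num) (by linarith))
        have h2 := h1.const_mul 5
        rw [mul_zero] at h2
        refine h2.congr fun n => ?_
        rw [← Real.rpow_natCast, ← Real.rpow_mul (by norm_num), neg_mul]
      have := ge_of_tendsto hlim ((eventually_ge_atTop N).mono hall)
      exact this.trans zero_le
    · have htop : Metric.ediam s ≠ ⊤ := ne_top_of_le_ne_top ENNReal.ofReal_ne_top hs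
      set D := (Metric.ediam s).toReal with hD
      have hD0 : 0 < D := ENNReal.toReal_pos h0 htop
      have hsD : Metric.ediam s = ENNReal.ofReal D := (ENNReal.ofReal_toReal htop).symm
      rw [hsD, ENNReal.ofReal_le_ofReal_iff (by positivity)] at hs
      have hD1 : D ≤ 1 := hs.trans (pow_le_one₀ (by norm_num) (by norm_num))
      obtain ⟨n, hn1, hn2⟩ := exists_nat_pow_near_of_lt_one hD0 hD1 (show (0:ℝ) < 3⁻¹ by norm_num) (by norm_num)
      have hNn : N ≤ n := by
        by_contra! h
        have : (3 : ℝ)⁻¹ ^ N ≤ 3⁻¹ ^ (n + 1) := pow_le_pow_of_le_one (by norm_num) (by norm_num) h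
        linarith
      refine (mass ht hδd hNn s (by rw [hsD]; exact ENNReal.ofReal_le_ofReal hn2)).trans ?_
      rw [hsD, ENNReal.ofReal_rpow_of_nonneg hD0.le hd0'.le, ← ENNReal.ofReal_mul hK0.le]
      apply ENNReal.ofReal_le_ofReal
      rw [hK, mul_assoc]
      apply mul_le_mul_of_nonneg_left _ (by norm_num)
      have h3 : ((3 : ℝ)⁻¹ ^ (n + 1)) ^ (d : ℝ) ≤ D ^ (d : ℝ) :=
        Real.rpow_le_rpow (by positivity) hn1.le hd0'.le
      have h4 : ((3 : ℝ)⁻¹ ^ (n + 1)) ^ (d : ℝ) = (3 : ℝ) ^ (-(((n + 1 : ℕ) : ℝ) * d)) := by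
        rw [Real.rpow_neg (by norm_num), Real.rpow_mul (by norm_num), Real.rpow_natCast, inv_pow,
          Real.inv_rpow (by positivity)]
      have h5 : (3 : ℝ) ^ (-(d * n : ℝ)) = (3 : ℝ) ^ (d : ℝ) * ((3 : ℝ)⁻¹ ^ (n + 1)) ^ (d : ℝ) := by
        rw [h4, ← Real.rpow_add (by norm_num)]
        congr 1; push_cast; ring
      rw [h5]
      gcongr
  have hKi : (ENNReal.ofReal K)⁻¹ ≠ 0 := ENNReal.inv_ne_zero.2 ENNReal.ofReal_ne_top
  have hK' : ENNReal.ofReal K ≠ 0 := by simpa using hK0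
  have hle : (ENNReal.ofReal K)⁻¹ • m ≤ OuterMeasure.mkMetric (fun r : ℝ≥0∞ => r ^ (d : ℝ)) := by
    apply OuterMeasure.le_mkMetric _ _ (ENNReal.ofReal ((3 : ℝ)⁻¹ ^ N))
    · simp
    · intro s hs
      rw [smul_apply, smul_eq_mul]
      calc _ ≤ (ENNReal.ofReal K)⁻¹ * (ENNReal.ofReal K * Metric.ediam s ^ (d : ℝ)) := by
            gcongr; exact hbound s hs
        _ = _ := by rw [← mul_assoc, ENNReal.inv_mul_cancel hK' ENNReal.ofReal_ne_top, one_mul]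
  have h1 := hle Xi
  rw [OuterMeasure.coe_mkMetric, smul_apply, smul_eq_mul, hmv] at h1
  have h2 : (fun ω => tv (X ω) 0) ⁻¹' Xi = Set.univ := by
    ext ω; simp only [Set.mem_preimage, Set.mem_univ, iff_true]
    exact ⟨X ω, X_valid ω, rfl⟩
  rw [h2, Set.univ_inter] at h1
  intro h3
  change _ ≤ μH[(d : ℝ)] Xi at h1
  rw [h3] at h1
  exact mul_ne_zero hKi hN (le_antisymm h1 zero_le)

end lower

end Trib

/-- **Example (multiplicative Tribonacci), Hausdorff dimension.**
`dim_H(Ξ) = 4 log₃ t` where `t > 1`, `t⁴ = t + 1`. -/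
theorem stmt16 (t : ℝ) (ht1 : 1 < t) (ht : t ^ 4 = t + 1) :
    dimH (XiSet {x : ℕ+ → Fin 3 | ∀ k : ℕ+,
        (x k = 1 → x (2 * k) = 0) ∧ (x k = 2 → x (2 * k) = 1)}) =
      ENNReal.ofReal (4 * Real.logb 3 t) := by
  have hp := Trib.pm_prob ht1 ht
  have hc := Trib.c_pos ht1
  rw [Trib.XiSet_eq]
  apply le_antisymm
  · refine le_of_forall_gt_imp_ge_of_dense fun b hb => ?_
    rcases eq_or_ne b ⊤ with rfl | hbt
    · exact le_top
    lift b to NNReal using hbt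
    apply dimH_le_of_hausdorffMeasure_ne_top
    apply Trib.upper ht1
    have h := (ENNReal.ofReal_lt_iff_lt_toReal (by positivity) ENNReal.coe_ne_top).1 hb
    simpa using h
  · refine le_of_forall_lt_imp_le_of_dense fun b hb => ?_
    have hbt : b ≠ ⊤ := ne_top_of_lt hb
    lift b to NNReal using hbt
    rcases eq_or_ne b 0 with rfl | h0
    · simp
    apply le_dimH_of_hausdorffMeasure_ne_zero
    apply Trib.lower ht1 b (pos_iff_ne_zero.2 h0)
    have h := (ENNReal.lt_ofReal_iff_toReal_lt ENNReal.coe_ne_top).1 hb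
    simpa using h
end
end
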